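/- Let 1 ≤ d < N be integers, α₀ ∈ ℝ^{N−d}, and let A ∈ ℝ^{d×(N−d)} be φ-semi multiplicatively badly approximable, where φ : [1,∞) → (0,1] is non-increasing and for every λ ≥ 1 there is c_λ > 0 with φ(λx) ≥ c_λ φ(x) for all x ≥ 1; let Ã ∈ ℝ^{(d+1)×(N−d)} be the matrix with first row α₀ and remaining rows those of A. Then for every ε' > 0 there is a constant C > 0, depending only on ε', N, d and φ, such that for every integer q ≥ 1 and every 0 < δ < 1/2: |𝒜(q,δ) − 2^{N−d} δ^{N−d} q^d| ≤ ε' δ^{N−d} q^d + C · [ (log((1/δ^{N−d})/φ(1/δ)))^d + (1/φ(1/δ)) · (log((1/δ^{N−d})/φ(1/δ)))^{d−1} ]. -/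

import Mathlib

open scoped BigOperators

/-- distance from a real number to the nearest integer -/
noncomputable def distNearestInt (x : ℝ) : ℝ := |x - (round x : ℤ)|

/-- the sup norm `|q|_∞` of an integer vector, as a real number -/
noncomputable def intSupNorm {k : ℕ} (q : Fin k → ℤ) : ℝ := ‖(fun j => (q j : ℝ))‖

section LatticeCount

variable {ι : Type*} [Fintype ι] [DecidableEq ι]

theorem natCard_quotient_range_mulVec (V : Matrix ι ι ℤ) (hV : V.det ≠ 0) :
    Nat.card ((ι → ℤ) ⧸ LinearMap.range (Matrix.toLin' V)) = V.det.natAbs := by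
  have hinj : Function.Injective (Matrix.toLin' V) := by
    rw [← LinearMap.ker_eq_bot, Matrix.ker_toLin'_eq_bot_iff]
    intro v hv
    exact Matrix.eq_zero_of_mulVec_eq_zero hV hv
  have h := Submodule.natAbs_det_equiv (LinearMap.range (Matrix.toLin' V))
    (LinearEquiv.ofInjective _ hinj)
  rw [← h, ← LinearMap.det_toLin']
  congr 2

theorem card_mul_abs_det_le_of_det_ne_zero (W : Matrix ι ι ℝ) (S : Finset (ι → ℤ))
    (hS : ∀ z ∈ S, ∀ i, |W.mulVec (fun j => (z j : ℝ)) i| ≤ 1)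
    (w₀ : ι → ι → ℤ) (hw₀ : ∀ i, w₀ i ∈ S) (hdet : (Matrix.of w₀).det ≠ 0) :
    (S.card : ℝ) * |W.det| ≤ 5 ^ Fintype.card ι * (Fintype.card ι).factorial := by
  classical
  obtain ⟨w, hw, hmax⟩ := Finset.exists_max_image (Fintype.piFinset fun _ : ι => S)
    (fun w => |(Matrix.of w).det|) ⟨w₀, by simpa using hw₀⟩
  simp only [Fintype.mem_piFinset] at hw hmax
  set V : Matrix ι ι ℤ := (Matrix.of w).transpose with hVdef
  have hVd : V.det = (Matrix.of w).det := Matrix.det_transpose _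
  have hV0 : V.det ≠ 0 := by
    rw [hVd, ← abs_pos]
    exact (abs_pos.2 hdet).trans_le (hmax w₀ hw₀)
  have hcr : ∀ z ∈ S, ∀ i, |V.cramer z i| ≤ |V.det| := by
    intro z hz i
    have h1 : V.updateCol i z = (Matrix.of (Function.update w i z)).transpose := by
      rw [hVdef, Matrix.updateCol_transpose]; rfl
    rw [Matrix.cramer_apply, h1, Matrix.det_transpose, hVd]
    apply hmax
    intro j
    by_cases hj : j = i
    · subst hj; simpa using hz
    · simpa [hj] using hw j
  have hcard := natCard_quotient_range_mulVec V hV0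
  have hfin : Finite ((ι → ℤ) ⧸ LinearMap.range (Matrix.toLin' V)) :=
    Nat.finite_of_card_ne_zero (by rw [hcard]; simpa using hV0)
  have := Fintype.ofFinite ((ι → ℤ) ⧸ LinearMap.range (Matrix.toLin' V))
  have hS5 : S.card ≤ 5 ^ Fintype.card ι * V.det.natAbs := by
    rw [← hcard, Nat.card_eq_fintype_card]
    refine Finset.card_le_mul_card_image_of_maps_to (t := Finset.univ)
      (f := fun z => Submodule.Quotient.mk (p := LinearMap.range (Matrix.toLin' V)) z)
      (fun _ _ => Finset.mem_univ _) _ ?_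
    intro b _
    rcases (Finset.filter (fun z => Submodule.Quotient.mk
      (p := LinearMap.range (Matrix.toLin' V)) z = b) S).eq_empty_or_nonempty with he | ⟨z₁, hz₁⟩
    · rw [he]; simp
    rw [Finset.mem_filter] at hz₁
    have hbox : (Fintype.piFinset fun _ : ι => Finset.Icc (-2 : ℤ) 2).card
        = 5 ^ Fintype.card ι := by simp
    rw [← hbox]
    refine (Finset.card_le_card (t := (Fintype.piFinset fun _ : ι => Finset.Icc (-2 : ℤ) 2).image
      (fun t => z₁ + V.mulVec t)) ?_).trans Finset.card_image_le
    intro z hz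
    rw [Finset.mem_filter] at hz
    have hmem := (Submodule.Quotient.eq _).1 (hz.2.trans hz₁.2.symm)
    obtain ⟨t, ht⟩ := hmem
    rw [Matrix.toLin'_apply] at ht
    refine Finset.mem_image.2 ⟨t, ?_, by rw [ht]; abel⟩
    have h2 : V.mulVec (V.cramer z - V.cramer z₁ - V.det • t) = 0 := by
      rw [Matrix.mulVec_sub, Matrix.mulVec_sub, Matrix.mulVec_cramer, Matrix.mulVec_cramer,
        Matrix.mulVec_smul, ht, smul_sub, sub_self]
    have h3 := Matrix.eq_zero_of_mulVec_eq_zero hV0 h2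
    rw [Fintype.mem_piFinset]
    intro i
    have h4 := congrFun h3 i
    simp only [Pi.sub_apply, Pi.smul_apply, smul_eq_mul, Pi.zero_apply] at h4
    have h5 := hcr z hz.1 i
    have h6 := hcr z₁ hz₁.1 i
    have h7 : |V.det| * |t i| ≤ |V.det| * 2 := by
      rw [← abs_mul, show V.det * t i = V.cramer z i - V.cramer z₁ i by linarith]
      have := abs_sub (V.cramer z i) (V.cramer z₁ i)
      linarith
    have h8 := le_of_mul_le_mul_left h7 (abs_pos.2 hV0)
    rw [Finset.mem_Icc]; exact abs_le.1 h8
  have hprod : |W.det| * |(V.det : ℝ)| ≤ (Fintype.card ι).factorial := by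
    have h1 : (V.det : ℝ) = (V.map (fun x : ℤ => (x : ℝ))).det := by
      have := RingHom.map_det (Int.castRingHom ℝ) V
      simpa using this
    rw [h1, ← abs_mul, ← Matrix.det_mul]
    have := Matrix.det_le (A := W * V.map (fun x : ℤ => (x : ℝ))) (abv := AbsoluteValue.abs)
      (x := (1 : ℝ)) (fun i j => hS (w j) (hw j) i)
    simpa using this
  calc (S.card : ℝ) * |W.det| ≤ (5 ^ Fintype.card ι * V.det.natAbs : ℕ) * |W.det| := by
        gcongr
    _ = 5 ^ Fintype.card ι * (|W.det| * |(V.det : ℝ)|) := by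
        push_cast [Nat.cast_natAbs]; ring
    _ ≤ _ := by gcongr

theorem card_le_of_span_ne_top (Y : Finset (ι → ℝ)) (hY : ∀ y ∈ Y, ∀ i, |y i| ≤ 1)
    (ρ : ℝ) (hρ : 0 < ρ) (hρ1 : ρ ≤ 1)
    (hsep : ∀ y ∈ Y, ∀ y' ∈ Y, (∀ i, |y i - y' i| < ρ) → y = y')
    (hspan : Submodule.span ℝ (Y : Set (ι → ℝ)) ≠ ⊤) :
    (Y.card : ℝ) ≤ (5 * Fintype.card ι / ρ) ^ (Fintype.card ι - 1) := by
  classical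
  obtain ⟨f, hf0, hf⟩ := Submodule.exists_le_ker_of_lt_top _ (lt_top_iff_ne_top.2 hspan)
  set c : ι → ℝ := fun i => f (Pi.single i 1) with hc
  have hfc : ∀ y, f y = ∑ i, y i * c i := by
    intro y
    rw [LinearMap.pi_apply_eq_sum_univ f y]
    simp only [smul_eq_mul, hc]
    refine Finset.sum_congr rfl fun i _ => ?_
    congr 2
    ext j
    simp [Pi.single_apply, eq_comm]
  have hne : Nonempty ι := by
    by_contra h
    rw [not_nonempty_iff] at h
    apply hf0
    ext y
    exact h.elim y
  obtain ⟨i₀, hi₀⟩ := Finite.exists_max (fun i => |c i|)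
  have hci : 0 < |c i₀| := by
    rw [abs_pos]
    intro h
    apply hf0
    ext i
    have := hi₀ i
    simp only [h, abs_zero] at this
    simpa [hc] using abs_nonpos_iff.1 this
  have hn : (0 : ℝ) < Fintype.card ι := by exact_mod_cast Fintype.card_pos
  set n : ℝ := (Fintype.card ι : ℝ) with hndef
  have hlin : ∀ y ∈ Y, f y = 0 := fun y hy => hf (Submodule.subset_span hy)
  have hcoord : ∀ y : ι → ℝ, f y = 0 → |y i₀| ≤ ∑ i ∈ Finset.univ.erase i₀, |y i| := by
    intro y hy
    rw [hfc, ← Finset.add_sum_erase _ _ (Finset.mem_univ i₀)] at hy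
    have h1 : |y i₀| * |c i₀| ≤ (∑ i ∈ Finset.univ.erase i₀, |y i|) * |c i₀| := by
      rw [← abs_mul, show y i₀ * c i₀ = -∑ i ∈ Finset.univ.erase i₀, y i * c i by linarith,
        abs_neg, Finset.sum_mul]
      refine (Finset.abs_sum_le_sum_abs _ _).trans (Finset.sum_le_sum fun i _ => ?_)
      rw [abs_mul]
      exact mul_le_mul_of_nonneg_left (hi₀ i) (abs_nonneg _)
    exact le_of_mul_le_mul_right h1 hci
  have hn1 : 1 ≤ n := by rw [hndef]; exact_mod_cast Fintype.card_pos
  set R : ℕ := ⌊n / ρ⌋₊ + 1 with hR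
  have hnR : n / ρ < R := by rw [hR]; push_cast; exact Nat.lt_floor_add_one _
  let g : (ι → ℝ) → (({i // i ≠ i₀}) → ℤ) := fun y i => ⌊n * y i / ρ⌋
  have hmaps : Set.MapsTo g Y (Fintype.piFinset fun _ : {i // i ≠ i₀} =>
      Finset.Ico (-(R : ℤ)) R : Finset _) := by
    intro y hy
    simp only [Finset.mem_coe, Fintype.mem_piFinset, Finset.mem_Ico, g]
    intro i
    have h1 := abs_le.1 (hY y hy i)
    have h2 : |n * y i / ρ| ≤ n / ρ := by
      rw [abs_div, abs_mul, abs_of_pos hn, abs_of_pos hρ]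
      gcongr
      nlinarith [hY y hy i]
    have h3 := abs_le.1 h2
    constructor
    · rw [Int.le_floor]; push_cast; linarith
    · rw [Int.floor_lt]; push_cast; linarith
  have hinj : Set.InjOn g Y := by
    intro y hy y' hy' hg
    apply hsep y hy y' hy'
    have h1 : ∀ i, i ≠ i₀ → |y i - y' i| < ρ / n := by
      intro i hi
      have h2 := congrFun hg ⟨i, hi⟩
      have h3 := Int.abs_sub_lt_one_of_floor_eq_floor h2
      rw [show n * y i / ρ - n * y' i / ρ = (y i - y' i) * (n / ρ) by ring, abs_mul,
        abs_of_pos (div_pos hn hρ)] at h3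
      rw [lt_div_iff₀ hn]
      rw [← mul_div_assoc, div_lt_iff₀ hρ] at h3
      linarith
    intro i
    by_cases hi : i = i₀
    · subst hi
      have h2 := hcoord (y - y') (by rw [map_sub, hlin y hy, hlin y' hy', sub_self])
      simp only [Pi.sub_apply] at h2
      refine h2.trans_lt ?_
      calc ∑ j ∈ Finset.univ.erase i, |y j - y' j|
          ≤ ∑ j ∈ Finset.univ.erase i, ρ / n :=
            Finset.sum_le_sum fun j hj => (h1 j (Finset.ne_of_mem_erase hj)).le
        _ = (n - 1) * (ρ / n) := by
            rw [Finset.sum_const, Finset.card_erase_of_mem (Finset.mem_univ _), nsmul_eq_mul,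
              Finset.card_univ, Nat.cast_sub Fintype.card_pos, Nat.cast_one]
        _ < ρ := by
            rw [← mul_div_assoc, div_lt_iff₀ hn]; nlinarith
    · exact (h1 i hi).trans_le (div_le_self hρ.le hn1)
  have hcard := Finset.card_le_card_of_injOn g hmaps hinj
  rw [Fintype.card_piFinset, Finset.prod_const, Finset.card_univ, Fintype.card_subtype_compl,
    Fintype.card_subtype_eq, Int.card_Ico] at hcard
  refine (Nat.cast_le.2 hcard).trans ?_
  push_cast
  gcongr
  have : (((R : ℤ) - -(R : ℤ)).toNat : ℝ) = 2 * R := by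
    rw [show (R : ℤ) - -(R : ℤ) = ((2 * R : ℕ) : ℤ) by push_cast; ring, Int.toNat_natCast]
    push_cast; ring
  rw [this, hR]
  push_cast
  have h1 : (⌊n / ρ⌋₊ : ℝ) ≤ n / ρ := Nat.floor_le (by positivity)
  have h2 : 1 ≤ n / ρ := by rw [le_div_iff₀ hρ]; linarith
  rw [mul_div_assoc]
  linarith

/-- A packing bound for lattice points in the unit cube in terms of the covolume and the
first minimum of the lattice. -/
theorem card_lattice_points_le (W : Matrix ι ι ℝ) (hW : W.det ≠ 0) (S : Finset (ι → ℤ))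
    (hS : ∀ z ∈ S, ∀ i, |W.mulVec (fun j => (z j : ℝ)) i| ≤ 1)
    (ρ : ℝ) (hρ : 0 < ρ) (hρ1 : ρ ≤ 1)
    (hsep : ∀ z : ι → ℤ, (∀ i, |W.mulVec (fun j => (z j : ℝ)) i| < ρ) → z = 0) :
    (S.card : ℝ) ≤ 5 ^ Fintype.card ι * (Fintype.card ι).factorial / |W.det| +
      (5 * Fintype.card ι / ρ) ^ (Fintype.card ι - 1) := by
  classical
  let F : (ι → ℤ) → (ι → ℝ) := fun z => W.mulVec (fun j => (z j : ℝ))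
  have hFsub : ∀ z z', F z - F z' = F (z - z') := by
    intro z z'
    simp only [F, ← Matrix.mulVec_sub]
    congr 1; ext j; simp
  have hsep' : ∀ z z', (∀ i, |F z i - F z' i| < ρ) → z = z' := by
    intro z z' h
    apply sub_eq_zero.1
    apply hsep
    intro i
    have := h i
    rwa [← Pi.sub_apply, hFsub] at this
  have hinj : Function.Injective F := by
    intro z z' h
    apply hsep'
    intro i; rw [h]; simpa using hρ
  by_cases hspan : Submodule.span ℝ ((S.image F : Finset _) : Set (ι → ℝ)) = ⊤
  · obtain ⟨f, hfm, -, hfl⟩ := Submodule.exists_fun_fin_finrank_span_eq ℝ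
      ((S.image F : Finset _) : Set (ι → ℝ))
    have hcard : Module.finrank ℝ (Submodule.span ℝ ((S.image F : Finset _) : Set (ι → ℝ)))
        = Fintype.card ι := by
      rw [hspan, finrank_top]; simp
    let e : ι ≃ Fin (Module.finrank ℝ
        (Submodule.span ℝ ((S.image F : Finset _) : Set (ι → ℝ)))) :=
      Fintype.equivOfCardEq (by simp [hcard])
    have hfl' : LinearIndependent ℝ (f ∘ e) := hfl.comp _ e.injective
    have hex : ∀ i, ∃ z ∈ S, F z = f (e i) := fun i => by simpa using hfm (e i)
    choose w hwS hwF using hex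
    have hdet : (Matrix.of w).det ≠ 0 := by
      intro h0
      have h1 : (Matrix.of fun i => F (w i)) =
          ((Matrix.of w).map (fun x : ℤ => (x : ℝ))) * W.transpose := by
        ext i j
        simp [F, Matrix.mul_apply, Matrix.mulVec, dotProduct, mul_comm]
      have h2 : ((Matrix.of w).map (fun x : ℤ => (x : ℝ))).det = 0 := by
        have := RingHom.map_det (Int.castRingHom ℝ) (Matrix.of w)
        rw [h0] at this
        simpa using this.symm
      have h3 : (Matrix.of fun i => F (w i)).det = 0 := by rw [h1, Matrix.det_mul, h2, zero_mul]
      have h4 : LinearIndependent ℝ (Matrix.of fun i => F (w i)).row := by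
        have : (Matrix.of fun i => F (w i)).row = f ∘ e := by
          ext i j; simp [Matrix.row, hwF]
        rw [this]; exact hfl'
      have h5 := (Matrix.linearIndependent_rows_iff_isUnit.1 h4)
      rw [Matrix.isUnit_iff_isUnit_det, h3] at h5
      simp at h5
    have h := card_mul_abs_det_le_of_det_ne_zero W S hS w hwS hdet
    rw [← le_div_iff₀ (abs_pos.2 hW)] at h
    have : 0 ≤ (5 * Fintype.card ι / ρ) ^ (Fintype.card ι - 1) := by positivity
    linarith
  · have h := card_le_of_span_ne_top (S.image F)
      (by simpa using fun z hz => hS z hz) ρ hρ hρ1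
      (by
        simp only [Finset.mem_image]
        rintro _ ⟨z, -, rfl⟩ _ ⟨z', -, rfl⟩ hzz
        rw [hsep' z z' hzz]) hspan
    rw [Finset.card_image_of_injective _ hinj] at h
    have : 0 ≤ 5 ^ Fintype.card ι * ((Fintype.card ι).factorial : ℝ) / |W.det| := by positivity
    linarith

end LatticeCount

theorem distNearestInt_nonneg (x : ℝ) : 0 ≤ distNearestInt x := abs_nonneg _

theorem distNearestInt_le_half (x : ℝ) : distNearestInt x ≤ 1 / 2 := abs_sub_round x

theorem distNearestInt_le_abs_sub (x : ℝ) (p : ℤ) : distNearestInt x ≤ |x - p| := round_le x p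

section BoxCount

variable {m d : ℕ}

theorem card_box_le (J : ℕ) (hJ : 1 ≤ J) (A : Matrix (Fin d) (Fin m) ℝ) (y : ℝ)
    (hbad : ∀ k : Fin m → ℤ, k ≠ 0 → (∀ j, |(k j : ℝ)| ≤ J) →
      y ≤ intSupNorm k ^ m * ∏ i, distNearestInt (∑ j, A i j * (k j : ℝ)))
    (s : Fin d → ℕ) (ρ : ℝ) (hρ : 0 < ρ) (hρ1 : ρ ≤ 1)
    (hρy : ρ ^ (m + d) * ((J : ℝ) ^ m / 2 ^ (∑ i, s i)) ≤ y) (hmd : 0 < m + d)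
    (S : Finset (Fin m → ℤ)) (hSJ : ∀ k ∈ S, ∀ j, |(k j : ℝ)| ≤ J)
    (hSs : ∀ k ∈ S, ∀ i, 2 ^ s i * distNearestInt (∑ j, A i j * (k j : ℝ)) ≤ 1) :
    (S.card : ℝ) ≤ 5 ^ (m + d) * (m + d).factorial * ((J : ℝ) ^ m / 2 ^ (∑ i, s i)) +
      (5 * (m + d : ℕ) / ρ) ^ (m + d - 1) := by
  classical
  have hJ0 : (0 : ℝ) < J := by exact_mod_cast hJ
  let W : Matrix (Fin m ⊕ Fin d) (Fin m ⊕ Fin d) ℝ :=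
    Matrix.fromBlocks (Matrix.diagonal fun _ => (J : ℝ)⁻¹) 0
      (Matrix.of fun i j => 2 ^ s i * A i j) (Matrix.diagonal fun i => -(2 : ℝ) ^ s i)
  have hl : ∀ (z : Fin m ⊕ Fin d → ℤ) (j : Fin m),
      W.mulVec (fun t => (z t : ℝ)) (Sum.inl j) = (J : ℝ)⁻¹ * z (Sum.inl j) := by
    intro z j
    simp [W, Matrix.fromBlocks_mulVec]
  have hr : ∀ (z : Fin m ⊕ Fin d → ℤ) (i : Fin d),
      W.mulVec (fun t => (z t : ℝ)) (Sum.inr i) =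
        2 ^ s i * ((∑ j, A i j * (z (Sum.inl j) : ℝ)) - z (Sum.inr i)) := by
    intro z i
    simp only [W, Matrix.fromBlocks_mulVec, Sum.elim_inr, Pi.add_apply, Matrix.mulVec_diagonal,
      Function.comp]
    simp only [Matrix.mulVec, dotProduct, Matrix.of_apply, mul_sub, Finset.mul_sum]
    simp only [mul_assoc, Function.comp_apply]; ring
  have hdet : |W.det| = 2 ^ (∑ i, s i) / (J : ℝ) ^ m := by
    simp only [W, Matrix.det_fromBlocks_zero₁₂, Matrix.det_diagonal, Finset.prod_const,
      Finset.card_univ, Fintype.card_fin, abs_mul, Finset.abs_prod, abs_neg, abs_pow, abs_two,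
      Finset.prod_pow_eq_pow_sum, abs_inv, Nat.abs_cast]
    rw [inv_pow]; field_simp
  have hdet0 : W.det ≠ 0 := by
    rw [← abs_pos, hdet]; positivity
  let G : (Fin m → ℤ) → (Fin m ⊕ Fin d → ℤ) := fun k =>
    Sum.elim k (fun i => round (∑ j, A i j * (k j : ℝ)))
  have hG : Function.Injective G := by
    intro k k' h
    ext j
    exact congrFun h (Sum.inl j)
  have h := card_lattice_points_le W hdet0 (S.image G) (by
    intro z hz i
    obtain ⟨k, hk, rfl⟩ := Finset.mem_image.1 hz
    rcases i with j | i
    · rw [hl, abs_mul, abs_inv, Nat.abs_cast, inv_mul_le_iff₀ hJ0, mul_one]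
      exact hSJ k hk j
    · rw [hr, abs_mul, abs_of_pos (by positivity)]
      exact hSs k hk i) ρ hρ hρ1 (by
    intro z hz
    by_contra hz0
    obtain ⟨lam, hlam, hlρ⟩ : ∃ lam, (∀ i, |W.mulVec (fun t => (z t : ℝ)) i| ≤ lam) ∧ lam < ρ := by
      have : Nonempty (Fin m ⊕ Fin d) := by
        rw [← Fintype.card_pos_iff]; simpa using hmd
      obtain ⟨i₀, hi₀⟩ := Finite.exists_max (fun i => |W.mulVec (fun t => (z t : ℝ)) i|)
      exact ⟨_, hi₀, hz i₀⟩
    have hlam1 : lam < 1 := hlρ.trans_le hρ1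
    have hlam0 : 0 ≤ lam := by
      have : Nonempty (Fin m ⊕ Fin d) := by
        rw [← Fintype.card_pos_iff]; simpa using hmd
      exact (abs_nonneg _).trans (hlam (Classical.arbitrary _))
    set k : Fin m → ℤ := fun j => z (Sum.inl j) with hk
    have hkb : ∀ j, |(k j : ℝ)| ≤ lam * J := by
      intro j
      have := hlam (Sum.inl j)
      rw [hl, abs_mul, abs_inv, Nat.abs_cast, inv_mul_le_iff₀ hJ0] at this
      rw [mul_comm]; exact this
    have hLb : ∀ i, |(∑ j, A i j * (k j : ℝ)) - z (Sum.inr i)| ≤ lam / 2 ^ s i := by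
      intro i
      have := hlam (Sum.inr i)
      rw [hr, abs_mul, abs_of_pos (by positivity)] at this
      rw [le_div_iff₀ (by positivity), mul_comm]; exact this
    by_cases hk0 : k = 0
    · apply hz0
      ext t
      rcases t with j | i
      · exact congrFun hk0 j
      · have h1 := hLb i
        rw [hk0] at h1
        simp only [Pi.zero_apply, Int.cast_zero, mul_zero, Finset.sum_const_zero, zero_sub,
          abs_neg] at h1
        have h2 : lam / 2 ^ s i ≤ lam := div_le_self hlam0 (one_le_pow₀ (by norm_num))
        have h3 : |(z (Sum.inr i) : ℝ)| < 1 := by linarith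
        have h4 : |z (Sum.inr i)| < 1 := by exact_mod_cast h3
        simpa using Int.abs_lt_one_iff.1 h4
    · have h1 := hbad k hk0 (fun j => (hkb j).trans (by nlinarith))
      have h2 : intSupNorm k ≤ lam * J := by
        refine (pi_norm_le_iff_of_nonneg (by positivity)).2 fun j => ?_
        rw [Real.norm_eq_abs]; exact hkb j
      have h3 : ∏ i, distNearestInt (∑ j, A i j * (k j : ℝ)) ≤ ∏ i, lam / 2 ^ s i :=
        Finset.prod_le_prod (fun i _ => distNearestInt_nonneg _)
          (fun i _ => (distNearestInt_le_abs_sub _ _).trans (hLb i))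
      have h4 : intSupNorm k ^ m * ∏ i, distNearestInt (∑ j, A i j * (k j : ℝ)) ≤
          (lam * J) ^ m * ∏ i, lam / 2 ^ s i := by
        have : 0 ≤ intSupNorm k := norm_nonneg _
        gcongr
        exact Finset.prod_nonneg fun i _ => distNearestInt_nonneg _
      have h5 : (lam * J) ^ m * ∏ i, lam / 2 ^ s i =
          lam ^ (m + d) * ((J : ℝ) ^ m / 2 ^ (∑ i, s i)) := by
        rw [Finset.prod_div_distrib, Finset.prod_const, Finset.card_univ, Fintype.card_fin,
          Finset.prod_pow_eq_pow_sum]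
        ring
      have h6 : lam ^ (m + d) < ρ ^ (m + d) := pow_lt_pow_left₀ hlρ hlam0 hmd.ne'
      have h7 : (0 : ℝ) < (J : ℝ) ^ m / 2 ^ (∑ i, s i) := by positivity
      nlinarith)
  rw [Finset.card_image_of_injective _ hG, hdet] at h
  simp only [Fintype.card_sum, Fintype.card_fin] at h
  refine h.trans (le_of_eq ?_)
  congr 1
  rw [div_div_eq_mul_div, mul_div_assoc]

theorem sum_pow_sub_sum_le (M : ℕ) (β : ℝ) (hβ : 0 ≤ β) (hβ1 : β < 1) :
    ∑ s ∈ (Fintype.piFinset fun _ : Fin (d + 1) => Finset.range (M + 1)) with ∑ i, s i ≤ M,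
      β ^ (M - ∑ i, s i) ≤ (M + 1 : ℝ) ^ d * (1 - β)⁻¹ := by
  classical
  set P := (Fintype.piFinset fun _ : Fin (d + 1) => Finset.range (M + 1)).filter
    (fun s => ∑ i, s i ≤ M)
  let g : (Fin (d + 1) → ℕ) → (Fin d → ℕ) × ℕ := fun s => (Fin.tail s, M - ∑ i, s i)
  have hinj : Set.InjOn g P := by
    intro s hs s' hs' h
    have hs1 := (Finset.mem_filter.1 hs).2
    have hs2 := (Finset.mem_filter.1 hs').2
    obtain ⟨h1, h2⟩ := Prod.mk.inj h
    rw [Fin.sum_univ_succ] at hs1 hs2 h2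
    rw [Fin.sum_univ_succ] at h2
    have h3 : ∑ i : Fin d, s i.succ = ∑ i : Fin d, s' i.succ :=
      Finset.sum_congr rfl fun i _ => congrFun h1 i
    rw [← Fin.cons_self_tail s, ← Fin.cons_self_tail s', h1]
    congr 1
    omega
  calc ∑ s ∈ P, β ^ (M - ∑ i, s i) = ∑ x ∈ P.image g, β ^ x.2 := by
        rw [Finset.sum_image hinj]
    _ ≤ ∑ x ∈ (Fintype.piFinset fun _ : Fin d => Finset.range (M + 1)) ×ˢ Finset.range (M + 1),
        β ^ x.2 := by
        refine Finset.sum_le_sum_of_subset_of_nonneg ?_ (fun _ _ _ => by positivity)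
        intro x hx
        obtain ⟨s, hs, rfl⟩ := Finset.mem_image.1 hx
        have hs1 := Fintype.mem_piFinset.1 (Finset.mem_filter.1 hs).1
        simp only [g, Finset.mem_product, Fintype.mem_piFinset, Finset.mem_range]
        exact ⟨fun i => Finset.mem_range.1 (hs1 i.succ), by omega⟩
    _ = (M + 1 : ℝ) ^ d * ∑ t ∈ Finset.range (M + 1), β ^ t := by
        rw [Finset.sum_product]
        simp
    _ ≤ (M + 1 : ℝ) ^ d * (1 - β)⁻¹ := by
        gcongr
        rw [← tsum_geometric_of_lt_one hβ hβ1]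
        exact (summable_geometric_of_lt_one hβ hβ1).sum_le_tsum _ (fun _ _ => by positivity)

theorem exists_sum_prod_inv_le (m d : ℕ) : ∃ C : ℝ, 0 < C ∧
    ∀ (J : ℕ), 1 ≤ J → ∀ (A : Matrix (Fin (d + 1)) (Fin m) ℝ) (y : ℝ), 0 < y →
    (∀ k : Fin m → ℤ, k ≠ 0 → (∀ j, |(k j : ℝ)| ≤ J) →
      y ≤ intSupNorm k ^ m * ∏ i, distNearestInt (∑ j, A i j * (k j : ℝ))) →
    ∀ M : ℕ, 2 ^ M ≤ (J : ℝ) ^ m / y → (J : ℝ) ^ m / y < 2 ^ (M + 1) →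
    ∑ k ∈ (Fintype.piFinset fun _ : Fin m => Finset.Icc (-(J : ℤ)) J).erase 0,
      ∏ i, (distNearestInt (∑ j, A i j * (k j : ℝ)))⁻¹ ≤
    C * ((J : ℝ) ^ m * (M + 1 : ℝ) ^ (d + 1) + (J : ℝ) ^ m / y * (M + 1 : ℝ) ^ d) := by
  classical
  set n : ℕ := m + (d + 1) with hn
  have hn0 : n ≠ 0 := by omega
  set β : ℝ := (1 / 2 : ℝ) ^ ((n : ℝ)⁻¹) with hβ
  have hβn : β ^ n = 1 / 2 := Real.rpow_inv_natCast_pow (by norm_num) hn0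
  have hβ0 : 0 < β := by positivity
  have hβ1 : β < 1 := by
    by_contra h
    have := one_le_pow₀ (n := n) (not_lt.1 h)
    rw [hβn] at this; norm_num at this
  set C₁ : ℝ := 5 ^ n * n.factorial with hC₁
  set C₂ : ℝ := (5 * (n : ℕ)) ^ (n - 1) with hC₂
  have hC₁0 : 0 < C₁ := by positivity
  have hn0' : (0 : ℝ) < n := by exact_mod_cast Nat.pos_of_ne_zero hn0
  have hC₂0 : 0 < C₂ := by positivity
  have hβ1' : 0 < 1 - β := by linarith
  refine ⟨2 ^ (d + 1) * (C₁ + C₂ * (1 - β)⁻¹), by positivity, ?_⟩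
  intro J hJ A y hy hbad M hM1 hM2
  have hJ0 : (0 : ℝ) < J := by exact_mod_cast hJ
  set Y : ℝ := (J : ℝ) ^ m / y with hY
  have hY0 : 0 < Y := by positivity
  set Box := (Fintype.piFinset fun _ : Fin m => Finset.Icc (-(J : ℤ)) J).erase 0 with hBox
  have hBoxk : ∀ k ∈ Box, k ≠ 0 ∧ ∀ j, |(k j : ℝ)| ≤ J := by
    intro k hk
    rw [hBox, Finset.mem_erase, Fintype.mem_piFinset] at hk
    refine ⟨hk.1, fun j => ?_⟩
    have := abs_le.2 (Finset.mem_Icc.1 (hk.2 j))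
    exact_mod_cast this
  have hpos : ∀ k ∈ Box, ∀ i, 0 < distNearestInt (∑ j, A i j * (k j : ℝ)) := by
    intro k hk i
    refine lt_of_le_of_ne (distNearestInt_nonneg _) fun h0 => ?_
    have h1 := hbad k (hBoxk k hk).1 (hBoxk k hk).2
    rw [Finset.prod_eq_zero (Finset.mem_univ i) h0.symm, mul_zero] at h1
    linarith
  have hprod : ∀ k ∈ Box, ∏ i, (distNearestInt (∑ j, A i j * (k j : ℝ)))⁻¹ ≤ Y := by
    intro k hk
    have h1 := hbad k (hBoxk k hk).1 (hBoxk k hk).2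
    have h2 : intSupNorm k ≤ J := by
      refine (pi_norm_le_iff_of_nonneg (by positivity)).2 fun j => ?_
      rw [Real.norm_eq_abs]; exact (hBoxk k hk).2 j
    have h3 : 0 < ∏ i, distNearestInt (∑ j, A i j * (k j : ℝ)) :=
      Finset.prod_pos fun i _ => hpos k hk i
    have h4 : intSupNorm k ^ m ≤ (J : ℝ) ^ m := pow_le_pow_left₀ (norm_nonneg _) h2 m
    rw [Finset.prod_inv_distrib, hY, inv_le_iff_one_le_mul₀ h3, div_mul_eq_mul_div,
      one_le_div hy]
    nlinarith
  have hν : ∀ x : ℝ, ∃ t : ℕ, 0 < x → x ≤ 1 → (2 : ℝ) ^ t ≤ x⁻¹ ∧ x⁻¹ < 2 ^ (t + 1) := by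
    intro x
    by_cases hx : 0 < x ∧ x ≤ 1
    · obtain ⟨t, ht⟩ := exists_nat_pow_near ((one_le_inv₀ hx.1).2 hx.2) (one_lt_two (α := ℝ))
      exact ⟨t, fun _ _ => ht⟩
    · exact ⟨0, fun h1 h2 => (hx ⟨h1, h2⟩).elim⟩
  choose ν hν using hν
  let σ : (Fin m → ℤ) → Fin (d + 1) → ℕ := fun k i =>
    ν (distNearestInt (∑ j, A i j * (k j : ℝ)))
  have hσ : ∀ k ∈ Box, ∀ i,
      (2 : ℝ) ^ σ k i ≤ (distNearestInt (∑ j, A i j * (k j : ℝ)))⁻¹ ∧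
      (distNearestInt (∑ j, A i j * (k j : ℝ)))⁻¹ < 2 ^ (σ k i + 1) := fun k hk i =>
    hν _ (hpos k hk i) ((distNearestInt_le_half _).trans (by norm_num))
  set P := (Fintype.piFinset fun _ : Fin (d + 1) => Finset.range (M + 1)).filter
    (fun s => ∑ i, s i ≤ M) with hP
  have hσP : ∀ k ∈ Box, σ k ∈ P := by
    intro k hk
    have h1 : (2 : ℝ) ^ (∑ i, σ k i) ≤ Y := by
      rw [← Finset.prod_pow_eq_pow_sum]
      exact (Finset.prod_le_prod (fun _ _ => by positivity) (fun i _ => (hσ k hk i).1)).trans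
        (hprod k hk)
    have h2 : ∑ i, σ k i < M + 1 :=
      (pow_lt_pow_iff_right₀ (one_lt_two (α := ℝ))).1 (h1.trans_lt hM2)
    rw [hP, Finset.mem_filter, Fintype.mem_piFinset]
    refine ⟨fun i => ?_, by omega⟩
    have := Finset.single_le_sum (f := σ k) (fun _ _ => Nat.zero_le _) (Finset.mem_univ i)
    rw [Finset.mem_range]; omega
  have hfiber : ∀ s ∈ P, ∑ k ∈ Box with σ k = s,
      ∏ i, (distNearestInt (∑ j, A i j * (k j : ℝ)))⁻¹ ≤
      2 ^ (d + 1) * (C₁ * (J : ℝ) ^ m + C₂ * (Y * β ^ (M - ∑ i, s i))) := by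
    intro s hs
    have hsM : ∑ i, s i ≤ M := (Finset.mem_filter.1 hs).2
    set τ := ∑ i, s i with hτ
    set ρ : ℝ := ((2 : ℝ) ^ τ / Y) ^ ((n : ℝ)⁻¹) with hρ
    have hρ0 : 0 < ρ := by positivity
    have hρn : ρ ^ n = 2 ^ τ / Y := Real.rpow_inv_natCast_pow (by positivity) hn0
    have hρβ : ρ ≤ β ^ (M - τ) := by
      refine le_of_pow_le_pow_left₀ hn0 (by positivity) ?_
      rw [hρn, ← pow_mul, mul_comm, pow_mul, hβn, div_le_iff₀ hY0]
      calc (2 : ℝ) ^ τ = (1 / 2) ^ (M - τ) * 2 ^ M := by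
            rw [← Nat.sub_add_cancel hsM, Nat.add_sub_cancel, pow_add, ← mul_assoc, ← mul_pow]
            norm_num
        _ ≤ _ := by gcongr
    have hρ1 : ρ ≤ 1 := hρβ.trans (pow_le_one₀ hβ0.le hβ1.le)
    have hcard := card_box_le J hJ A y hbad s ρ hρ0 hρ1 (by
      rw [← hn, hρn, ← hτ, hY]
      apply le_of_eq
      field_simp) (by omega) (Box.filter fun k => σ k = s)
      (fun k hk => (hBoxk k (Finset.mem_filter.1 hk).1).2)
      (fun k hk i => by
        obtain ⟨hk1, rfl⟩ := Finset.mem_filter.1 hk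
        have := (hσ k hk1 i).1
        rwa [le_inv_comm₀ (by positivity) (hpos k hk1 i), ← one_div,
          le_div_iff₀ (by positivity), mul_comm] at this)
    rw [← hn, ← hτ] at hcard
    have hterm : ∀ k ∈ Box.filter (fun k => σ k = s),
        ∏ i, (distNearestInt (∑ j, A i j * (k j : ℝ)))⁻¹ ≤ 2 ^ (d + 1) * 2 ^ τ := by
      intro k hk
      obtain ⟨hk1, rfl⟩ := Finset.mem_filter.1 hk
      calc ∏ i, (distNearestInt (∑ j, A i j * (k j : ℝ)))⁻¹ ≤ ∏ i, (2 : ℝ) ^ (σ k i + 1) :=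
            Finset.prod_le_prod (fun i _ => inv_nonneg.2 (distNearestInt_nonneg _))
              (fun i _ => (hσ k hk1 i).2.le)
        _ = 2 ^ (d + 1) * 2 ^ τ := by
            rw [Finset.prod_pow_eq_pow_sum, Finset.sum_add_distrib, pow_add, mul_comm]
            simp [hτ]
    calc _ ≤ _ := Finset.sum_le_card_nsmul _ _ _ hterm
      _ = ((Box.filter fun k => σ k = s).card : ℝ) * (2 ^ (d + 1) * 2 ^ τ) := nsmul_eq_mul _ _
      _ ≤ (C₁ * ((J : ℝ) ^ m / 2 ^ τ) + (5 * (n : ℕ) / ρ) ^ (n - 1)) *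
          (2 ^ (d + 1) * 2 ^ τ) := by gcongr
      _ = 2 ^ (d + 1) * (C₁ * (J : ℝ) ^ m + C₂ * (Y * ρ)) := by
          have h1 : (2 : ℝ) ^ τ = Y * (ρ ^ (n - 1) * ρ) := by
            rw [← pow_succ, Nat.sub_add_cancel (by omega), hρn]; field_simp
          have h2 : (2 : ℝ) ^ τ / ρ ^ (n - 1) = Y * ρ := by
            rw [h1]; field_simp
          rw [div_pow, ← h2, hC₂]
          field_simp
      _ ≤ _ := by gcongr
  rw [← Finset.sum_fiberwise_of_maps_to hσP]
  refine (Finset.sum_le_sum hfiber).trans ?_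
  rw [← Finset.mul_sum, Finset.sum_add_distrib, Finset.sum_const, nsmul_eq_mul, ← Finset.mul_sum,
    ← Finset.mul_sum]
  have hPcard : (P.card : ℝ) ≤ (M + 1 : ℝ) ^ (d + 1) := by
    have : P.card ≤ (M + 1) ^ (d + 1) := (Finset.card_filter_le _ _).trans (by simp)
    exact_mod_cast this
  have hgeom := sum_pow_sub_sum_le (d := d) M β hβ0.le hβ1
  have hr : 0 ≤ (1 - β)⁻¹ := by positivity
  calc _ ≤ 2 ^ (d + 1) * ((M + 1 : ℝ) ^ (d + 1) * (C₁ * (J : ℝ) ^ m) +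
        C₂ * (Y * ((M + 1 : ℝ) ^ d * (1 - β)⁻¹))) := by gcongr
    _ = 2 ^ (d + 1) * (C₁ * ((J : ℝ) ^ m * (M + 1 : ℝ) ^ (d + 1)) +
        (C₂ * (1 - β)⁻¹) * (Y * (M + 1 : ℝ) ^ d)) := by ring
    _ ≤ 2 ^ (d + 1) * ((C₁ + C₂ * (1 - β)⁻¹) * ((J : ℝ) ^ m * (M + 1 : ℝ) ^ (d + 1)) +
        (C₁ + C₂ * (1 - β)⁻¹) * (Y * (M + 1 : ℝ) ^ d)) := by
        gcongr
        · linarith [mul_nonneg hC₂0.le hr]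
        · linarith
    _ = _ := by ring

end BoxCount

section Fejer

/-- The additive character `x ↦ e^{2πix}`. -/
noncomputable def unitExp (x : ℝ) : ℂ := Complex.exp (((2 * Real.pi * x : ℝ) : ℂ) * Complex.I)

theorem norm_unitExp (x : ℝ) : ‖unitExp x‖ = 1 := Complex.norm_exp_ofReal_mul_I _

theorem unitExp_zero : unitExp 0 = 1 := by simp [unitExp]

theorem unitExp_add (x y : ℝ) : unitExp (x + y) = unitExp x * unitExp y := by
  rw [unitExp, unitExp, unitExp, ← Complex.exp_add]; push_cast; ring_nf

theorem unitExp_sum {α : Type*} (s : Finset α) (f : α → ℝ) :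
    unitExp (∑ i ∈ s, f i) = ∏ i ∈ s, unitExp (f i) := by
  classical
  induction s using Finset.induction_on with
  | empty => simp [unitExp_zero]
  | insert a s ha ih => rw [Finset.sum_insert ha, Finset.prod_insert ha, unitExp_add, ih]

theorem unitExp_intCast (n : ℤ) : unitExp n = 1 := by
  rw [unitExp, Complex.exp_eq_one_iff]
  exact ⟨n, by push_cast; ring⟩

theorem unitExp_natCast_mul (n : ℕ) (x : ℝ) : unitExp (n * x) = unitExp x ^ n := by
  rw [unitExp, unitExp, ← Complex.exp_nat_mul]; push_cast; ring_nf

theorem conj_unitExp (x : ℝ) : (starRingEnd ℂ) (unitExp x) = unitExp (-x) := by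
  rw [unitExp, unitExp, ← Complex.exp_conj, map_mul, Complex.conj_ofReal, Complex.conj_I]
  push_cast; ring_nf

theorem continuous_unitExp : Continuous unitExp := by
  unfold unitExp; fun_prop

theorem norm_unitExp_sub_one (x : ℝ) : ‖unitExp x - 1‖ = 2 * |Real.sin (Real.pi * x)| := by
  have := Complex.norm_exp_I_mul_ofReal_sub_one (2 * Real.pi * x)
  rw [mul_comm Complex.I] at this
  rw [unitExp, this, Real.norm_eq_abs, abs_mul, abs_two]
  congr 3; ring

theorem abs_sin_pi_mul_sub_round (x : ℝ) :
    |Real.sin (Real.pi * (x - round x))| = |Real.sin (Real.pi * x)| := by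
  rw [mul_sub, mul_comm Real.pi (round x : ℝ), Real.sin_sub_int_mul_pi, abs_mul]
  simp

theorem two_mul_distNearestInt_le_abs_sin (x : ℝ) :
    2 * distNearestInt x ≤ |Real.sin (Real.pi * x)| := by
  rw [← abs_sin_pi_mul_sub_round]
  have h := abs_sub_round x
  have hpi := Real.pi_pos
  have h1 := Real.mul_abs_le_abs_sin (x := Real.pi * (x - round x))
    (by rw [abs_mul, abs_of_pos hpi]; nlinarith)
  rw [abs_mul, abs_of_pos hpi] at h1
  refine le_trans (le_of_eq ?_) h1
  rw [distNearestInt]; field_simp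

theorem abs_sin_le_pi_mul_distNearestInt (x : ℝ) :
    |Real.sin (Real.pi * x)| ≤ Real.pi * distNearestInt x := by
  rw [← abs_sin_pi_mul_sub_round]
  refine Real.abs_sin_le_abs.trans (le_of_eq ?_)
  rw [abs_mul, abs_of_pos Real.pi_pos, distNearestInt]

theorem distNearestInt_le_add (x y : ℝ) :
    distNearestInt x ≤ |x - y| + distNearestInt y :=
  (distNearestInt_le_abs_sub x (round y)).trans (abs_sub_le x y _)

theorem abs_le_distNearestInt {x : ℝ} (hx : |x| ≤ 1 / 2) : |x| ≤ distNearestInt x := by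
  rw [distNearestInt]
  rcases eq_or_ne (round x) 0 with h | h
  · simp [h]
  · have h1 : (1 : ℝ) ≤ |(round x : ℝ)| := by exact_mod_cast Int.one_le_abs h
    have h2 := abs_sub_abs_le_abs_sub (round x : ℝ) x
    rw [abs_sub_comm] at h2
    linarith

/-- The Fejér kernel `n⁻¹ |∑_{h<n} e(hx)|²`. -/
noncomputable def fejerKernel (n : ℕ) (x : ℝ) : ℝ :=
  ‖∑ h ∈ Finset.range n, unitExp (h * x)‖ ^ 2 / n

theorem fejerKernel_nonneg (n : ℕ) (x : ℝ) : 0 ≤ fejerKernel n x := by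
  unfold fejerKernel; positivity

theorem norm_sum_unitExp_mul (n : ℕ) (x : ℝ) :
    ‖∑ h ∈ Finset.range n, unitExp (h * x)‖ * |Real.sin (Real.pi * x)| =
      |Real.sin (Real.pi * (n * x))| := by
  have h := geom_sum_mul (unitExp x) n
  simp_rw [← unitExp_natCast_mul] at h
  have h2 := congrArg norm h
  rw [norm_mul, norm_unitExp_sub_one, norm_unitExp_sub_one] at h2
  linarith

theorem fejerKernel_mul_sin_sq {n : ℕ} (hn : 1 ≤ n) (x : ℝ) :
    fejerKernel n x * (n * Real.sin (Real.pi * x) ^ 2) = Real.sin (Real.pi * (n * x)) ^ 2 := by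
  have hn0 : (n : ℝ) ≠ 0 := by positivity
  rw [← sq_abs (Real.sin (Real.pi * (n * x))), ← norm_sum_unitExp_mul, fejerKernel,
    ← sq_abs (Real.sin (Real.pi * x))]
  generalize ‖∑ h ∈ Finset.range n, unitExp (h * x)‖ = t
  generalize |Real.sin (Real.pi * x)| = s
  field_simp

theorem fejerKernel_mul_le_one {n : ℕ} (hn : 1 ≤ n) (x : ℝ) :
    fejerKernel n x * (4 * n * distNearestInt x ^ 2) ≤ 1 := by
  have h1 := fejerKernel_mul_sin_sq hn x
  have h2 := two_mul_distNearestInt_le_abs_sin x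
  have h3 := Real.sin_sq_le_one (Real.pi * (n * x))
  have h4 : (2 * distNearestInt x) ^ 2 ≤ Real.sin (Real.pi * x) ^ 2 := by
    rw [← sq_abs (Real.sin (Real.pi * x))]
    exact pow_le_pow_left₀ (mul_nonneg zero_le_two (distNearestInt_nonneg x)) h2 2
  calc fejerKernel n x * (4 * n * distNearestInt x ^ 2)
      = fejerKernel n x * (n * (2 * distNearestInt x) ^ 2) := by ring
    _ ≤ fejerKernel n x * (n * Real.sin (Real.pi * x) ^ 2) := by
        have := fejerKernel_nonneg n x
        gcongr
    _ ≤ 1 := by rw [h1]; exact h3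

theorem one_le_fejerKernel_add_shift {n : ℕ} (hn : 1 ≤ n) (x : ℝ) :
    1 ≤ (fejerKernel n x + fejerKernel n (x + 1 / (2 * n))) *
      (n * (Real.pi * (distNearestInt x + 1 / (2 * n))) ^ 2) := by
  have hn0 : (0 : ℝ) < n := by exact_mod_cast hn
  have h1 := fejerKernel_mul_sin_sq hn x
  have h2 := fejerKernel_mul_sin_sq hn (x + 1 / (2 * n))
  rw [show Real.pi * (n * (x + 1 / (2 * n))) = Real.pi * (n * x) + Real.pi / 2 by field_simp,
    Real.sin_add_pi_div_two] at h2
  have hD : ∀ y, distNearestInt y ≤ distNearestInt x + 1 / (2 * n) →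
      Real.sin (Real.pi * y) ^ 2 ≤ (Real.pi * (distNearestInt x + 1 / (2 * n))) ^ 2 := by
    intro y hy
    rw [← sq_abs (Real.sin _)]
    refine pow_le_pow_left₀ (abs_nonneg _) ((abs_sin_le_pi_mul_distNearestInt y).trans ?_) 2
    have := Real.pi_pos
    gcongr
  have h3 := hD x (by have : (0 : ℝ) ≤ 1 / (2 * n) := by positivity
                      linarith)
  have h4 := hD (x + 1 / (2 * n)) (by
    have := distNearestInt_le_add (x + 1 / (2 * n)) x
    rw [add_sub_cancel_left, abs_of_nonneg (by positivity)] at this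
    linarith)
  have h5 := Real.sin_sq_add_cos_sq (Real.pi * (n * x))
  have h6 := fejerKernel_nonneg n x
  have h7 := fejerKernel_nonneg n (x + 1 / (2 * n))
  calc (1 : ℝ) = _ := h5.symm
    _ = fejerKernel n x * (n * Real.sin (Real.pi * x) ^ 2) +
        fejerKernel n (x + 1 / (2 * n)) * (n * Real.sin (Real.pi * (x + 1 / (2 * n))) ^ 2) := by
          rw [h1, h2]
    _ ≤ _ := by
      rw [add_mul]
      exact add_le_add (mul_le_mul_of_nonneg_left (mul_le_mul_of_nonneg_left h3 hn0.le) h6)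
        (mul_le_mul_of_nonneg_left (mul_le_mul_of_nonneg_left h4 hn0.le) h7)

theorem continuous_fejerKernel (n : ℕ) : Continuous (fejerKernel n) := by
  unfold fejerKernel
  refine Continuous.div_const (Continuous.pow (Continuous.norm ?_) 2) _
  exact continuous_finsetSum _ fun h _ => continuous_unitExp.comp (by fun_prop)

theorem fejerKernel_sub_intCast (n : ℕ) (x : ℝ) (p : ℤ) :
    fejerKernel n (x - p) = fejerKernel n x := by
  unfold fejerKernel
  congr 3
  refine Finset.sum_congr rfl fun h _ => ?_
  rw [show (h : ℝ) * (x - p) = h * x + ((-(h * p) : ℤ) : ℝ) by push_cast; ring, unitExp_add,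
    unitExp_intCast, mul_one]

theorem fejerKernel_neg (n : ℕ) (x : ℝ) : fejerKernel n (-x) = fejerKernel n x := by
  unfold fejerKernel
  congr 2
  rw [← Complex.norm_conj, map_sum]
  congr 1
  refine Finset.sum_congr rfl fun h _ => ?_
  rw [conj_unitExp, mul_neg, neg_neg]

/-- `f` is a trigonometric polynomial of degree at most `J` with constant coefficient `b`,
all of whose coefficients are bounded by `b`. -/
def IsTrigPoly (f : ℝ → ℝ) (J : ℕ) (b : ℝ) : Prop :=
  ∃ c : ℤ → ℂ, c 0 = b ∧ (∀ h, ‖c h‖ ≤ b) ∧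
    ∀ x, (f x : ℂ) = ∑ h ∈ Finset.Icc (-(J : ℤ)) J, c h * unitExp (h * x)

theorem IsTrigPoly.nonneg {f : ℝ → ℝ} {J : ℕ} {b : ℝ} (hf : IsTrigPoly f J b) : 0 ≤ b := by
  obtain ⟨c, -, h, -⟩ := hf
  exact (norm_nonneg _).trans (h 0)

theorem IsTrigPoly.mono {f : ℝ → ℝ} {n J : ℕ} {b : ℝ} (hf : IsTrigPoly f n b) (hnJ : n ≤ J) :
    IsTrigPoly f J b := by
  have hb := hf.nonneg
  obtain ⟨c, h0, hc, hfc⟩ := hf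
  refine ⟨fun h => if h ∈ Finset.Icc (-(n : ℤ)) n then c h else 0, by simp [h0], ?_, ?_⟩
  · intro h
    dsimp only
    split_ifs
    · exact hc h
    · simpa using hb
  · intro x
    rw [hfc, ← Finset.sum_subset (Finset.Icc_subset_Icc (neg_le_neg (Nat.cast_le.2 hnJ))
      (Nat.cast_le.2 hnJ))]
    · refine Finset.sum_congr rfl fun h hh => ?_
      simp only [if_pos hh]
    · intro h _ hh
      simp only [if_neg hh, zero_mul]

theorem IsTrigPoly.add {f g : ℝ → ℝ} {J : ℕ} {a b : ℝ} (hf : IsTrigPoly f J a)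
    (hg : IsTrigPoly g J b) : IsTrigPoly (fun x => f x + g x) J (a + b) := by
  obtain ⟨c, h0, hc, hfc⟩ := hf
  obtain ⟨c', h0', hc', hfc'⟩ := hg
  refine ⟨fun h => c h + c' h, by simp [h0, h0'],
    fun h => (norm_add_le _ _).trans (add_le_add (hc h) (hc' h)), fun x => ?_⟩
  push_cast
  simp only [hfc, hfc', add_mul, Finset.sum_add_distrib]

theorem IsTrigPoly.const_mul {f : ℝ → ℝ} {J : ℕ} {a : ℝ} (hf : IsTrigPoly f J a) {t : ℝ}
    (ht : 0 ≤ t) : IsTrigPoly (fun x => t * f x) J (t * a) := by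
  obtain ⟨c, h0, hc, hfc⟩ := hf
  refine ⟨fun h => t * c h, by simp [h0], fun h => ?_, fun x => ?_⟩
  · rw [norm_mul, Complex.norm_real, Real.norm_of_nonneg ht]
    exact mul_le_mul_of_nonneg_left (hc h) ht
  · push_cast
    simp only [hfc, mul_assoc, Finset.mul_sum]

theorem IsTrigPoly.shift {f : ℝ → ℝ} {J : ℕ} {a : ℝ} (hf : IsTrigPoly f J a) (s : ℝ) :
    IsTrigPoly (fun x => f (x + s)) J a := by
  obtain ⟨c, h0, hc, hfc⟩ := hf
  refine ⟨fun h => c h * unitExp (h * s), by simp [h0, unitExp_zero], fun h => ?_, fun x => ?_⟩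
  · rw [norm_mul, norm_unitExp, mul_one]; exact hc h
  · simp only [hfc]
    refine Finset.sum_congr rfl fun h _ => ?_
    rw [mul_add, unitExp_add]; ring

theorem IsTrigPoly.convolve {f : ℝ → ℝ} {J : ℕ} {a : ℝ} (hf : IsTrigPoly f J a) {r : ℝ}
    (hr : 0 ≤ r) : IsTrigPoly (fun x => ∫ y in (-r)..r, f (x - y)) J (2 * r * a) := by
  obtain ⟨c, h0, hc, hfc⟩ := hf
  refine ⟨fun h => c h * ∫ y in (-r)..r, unitExp (h * (-y)), ?_, fun h => ?_, fun x => ?_⟩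
  · simp [h0, unitExp_zero]; ring
  · have h1 := intervalIntegral.norm_integral_le_of_norm_le_const (a := -r) (b := r)
      (f := fun y => unitExp (h * (-y))) (C := 1) (fun y _ => (norm_unitExp _).le)
    rw [sub_neg_eq_add, abs_of_nonneg (by linarith), one_mul] at h1
    rw [norm_mul, mul_comm, two_mul]
    exact mul_le_mul h1 (hc h) (norm_nonneg _) (by linarith)
  · rw [← intervalIntegral.integral_ofReal]
    simp only [hfc]
    rw [intervalIntegral.integral_finsetSum]
    · refine Finset.sum_congr rfl fun h _ => ?_
      rw [mul_assoc, mul_comm (∫ y in (-r)..r, unitExp (h * (-y))), ← mul_assoc,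
        ← intervalIntegral.integral_const_mul]
      refine intervalIntegral.integral_congr fun y _ => ?_
      rw [sub_eq_add_neg, mul_add, unitExp_add, mul_assoc]
    · intro h _
      exact (continuous_const.mul (continuous_unitExp.comp (by fun_prop))).intervalIntegrable _ _

theorem isTrigPoly_fejerKernel {n : ℕ} (hn : 1 ≤ n) : IsTrigPoly (fejerKernel n) n 1 := by
  have hn0 : (n : ℝ) ≠ 0 := by positivity
  let Q : ℤ → Finset (ℕ × ℕ) := fun l =>
    (Finset.range n ×ˢ Finset.range n).filter (fun p => (p.1 : ℤ) - p.2 = l)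
  have hQ : ∀ l, (Q l).card ≤ n := by
    intro l
    calc (Q l).card ≤ (Finset.range n).card := by
          refine Finset.card_le_card_of_injOn Prod.fst ?_ ?_
          · intro p hp
            exact (Finset.mem_product.1 (Finset.mem_filter.1 hp).1).1
          · intro p hp p' hp' h
            have h1 := (Finset.mem_filter.1 hp).2
            have h2 := (Finset.mem_filter.1 hp').2
            ext
            · exact h
            · omega
      _ = n := Finset.card_range n
  have hQ0 : (Q 0).card = n := by
    have : Q 0 = (Finset.range n).image (fun i => (i, i)) := by
      ext ⟨i, j⟩
      simp only [Q, Finset.mem_filter, Finset.mem_product, Finset.mem_range, Finset.mem_image,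
        Prod.mk.injEq]
      constructor
      · rintro ⟨⟨h1, h2⟩, h3⟩
        exact ⟨i, h1, rfl, by omega⟩
      · rintro ⟨a, h, rfl, rfl⟩
        exact ⟨⟨h, h⟩, by simp⟩
    rw [this, Finset.card_image_of_injective _ (fun a b h => (Prod.mk.inj h).1),
      Finset.card_range]
  refine ⟨fun l => (((Q l).card / n : ℝ) : ℂ), ?_, fun l => ?_, fun x => ?_⟩
  · simp only [hQ0, div_self hn0]
  · rw [Complex.norm_real, Real.norm_of_nonneg (by positivity)]
    exact div_le_one_of_le₀ (by exact_mod_cast hQ l) (by positivity)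
  · have h1 : ((‖∑ h ∈ Finset.range n, unitExp (h * x)‖ ^ 2 : ℝ) : ℂ) =
        ∑ p ∈ Finset.range n ×ˢ Finset.range n, unitExp (((p.1 : ℤ) - p.2 : ℤ) * x) := by
      rw [Complex.ofReal_pow, ← Complex.mul_conj', map_sum, Finset.sum_mul_sum,
        Finset.sum_product]
      refine Finset.sum_congr rfl fun i _ => Finset.sum_congr rfl fun j _ => ?_
      rw [conj_unitExp, ← unitExp_add]
      congr 1; push_cast; ring
    have h2 : ∀ p ∈ Finset.range n ×ˢ Finset.range n,
        (p.1 : ℤ) - p.2 ∈ Finset.Icc (-(n : ℤ)) n := by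
      intro p hp
      simp only [Finset.mem_product, Finset.mem_range] at hp
      rw [Finset.mem_Icc]; omega
    rw [fejerKernel, Complex.ofReal_div, h1, ← Finset.sum_fiberwise_of_maps_to h2, Finset.sum_div]
    refine Finset.sum_congr rfl fun l _ => ?_
    rw [Finset.sum_congr rfl (g := fun _ => unitExp (l * x))]
    · rw [Finset.sum_const, nsmul_eq_mul]
      push_cast
      simp only [Q]
      ring
    · intro p hp
      rw [(Finset.mem_filter.1 hp).2]

theorem integral_unitExp_eq_zero {h : ℤ} (hh : h ≠ 0) :
    ∫ y in (-(1 / 2) : ℝ)..(1 / 2), unitExp (h * y) = 0 := by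
  have hc : (2 * Real.pi * h * Complex.I : ℂ) ≠ 0 := by
    have := Real.pi_ne_zero
    simp [this, hh]
  have h1 := integral_exp_mul_complex (a := -(1 / 2)) (b := 1 / 2) hc
  have h2 : ∀ y : ℝ, unitExp (h * y) = Complex.exp (2 * Real.pi * h * Complex.I * y) := by
    intro y; rw [unitExp]; push_cast; ring_nf
  simp only [h2, h1]
  rw [← h2, ← h2]
  have h3 : unitExp (h * (1 / 2)) = unitExp (h * -(1 / 2)) := by
    rw [show (h : ℝ) * (1 / 2) = h * -(1 / 2) + (h : ℤ) by ring, unitExp_add,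
      unitExp_intCast, mul_one]
  rw [h3, sub_self, zero_div]

theorem IsTrigPoly.integral_eq {f : ℝ → ℝ} {J : ℕ} {a : ℝ} (hf : IsTrigPoly f J a) :
    ∫ y in (-(1 / 2) : ℝ)..(1 / 2), f y = a := by
  obtain ⟨c, h0, hc, hfc⟩ := hf
  rw [← Complex.ofReal_inj, ← intervalIntegral.integral_ofReal]
  simp only [hfc]
  rw [intervalIntegral.integral_finsetSum]
  · simp only [intervalIntegral.integral_const_mul]
    rw [Finset.sum_eq_single 0]
    · simp [unitExp_zero, h0]; norm_num
    · intro h _ hh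
      rw [integral_unitExp_eq_zero hh, mul_zero]
    · intro h; simp at h
  · intro h _
    exact (continuous_const.mul (continuous_unitExp.comp (by fun_prop))).intervalIntegrable _ _

end Fejer

section Majorants

theorem one_sub_le_integral_fejerKernel {n : ℕ} (hn : 1 ≤ n) {s : ℝ} (hs : 0 < s)
    (hs2 : s ≤ 1 / 2) : 1 - 1 / (2 * n * s) ≤ ∫ y in (-s)..s, fejerKernel n y := by
  have hn0 : (0 : ℝ) < n := by exact_mod_cast hn
  have hint : ∀ a b : ℝ, IntervalIntegrable (fejerKernel n) MeasureTheory.volume a b :=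
    fun a b => (continuous_fejerKernel n).intervalIntegrable a b
  have h1 := (isTrigPoly_fejerKernel hn).integral_eq
  have h2 : ∫ y in (-(1 / 2) : ℝ)..(-s), fejerKernel n y = ∫ y in s..(1 / 2), fejerKernel n y := by
    rw [← intervalIntegral.integral_comp_neg]
    simp only [fejerKernel_neg]
  have h3 : ∫ y in s..(1 / 2), fejerKernel n y ≤ 1 / (4 * n * s) := by
    have h0 : (0 : ℝ) ∉ Set.uIcc s (1 / 2) := by
      rw [Set.uIcc_of_le hs2]; intro h; linarith [h.1]
    calc ∫ y in s..(1 / 2), fejerKernel n y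
        ≤ ∫ y in s..(1 / 2), 1 / (4 * n) * y ^ (-2 : ℤ) := by
          refine intervalIntegral.integral_mono_on hs2 (hint _ _) ?_ ?_
          · exact (intervalIntegral.intervalIntegrable_zpow (Or.inr h0)).const_mul _
          · intro y hy
            have hy0 : 0 < y := hs.trans_le hy.1
            have h4 := fejerKernel_mul_le_one hn y
            have h5 := abs_le_distNearestInt (x := y) (by rw [abs_of_pos hy0]; exact hy.2)
            rw [abs_of_pos hy0] at h5
            have h6 : fejerKernel n y * (4 * n * y ^ 2) ≤ 1 := by
              refine le_trans ?_ h4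
              have := fejerKernel_nonneg n y
              gcongr
            rw [zpow_neg, ← div_eq_mul_inv, div_div]
            rw [le_div_iff₀ (by positivity)]
            exact_mod_cast h6
      _ = 1 / (4 * n) * (1 / s - 2) := by
          rw [intervalIntegral.integral_const_mul, integral_zpow (Or.inr ⟨by norm_num, h0⟩)]
          norm_num
          left; ring
      _ ≤ 1 / (4 * n) * (1 / s) := by
          gcongr; linarith
      _ = 1 / (4 * n * s) := by field_simp
  have h4 : (∫ y in (-(1 / 2) : ℝ)..(-s), fejerKernel n y) + (∫ y in (-s)..s, fejerKernel n y) +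
      (∫ y in s..(1 / 2), fejerKernel n y) = 1 := by
    rw [intervalIntegral.integral_add_adjacent_intervals (hint _ _) (hint _ _),
      intervalIntegral.integral_add_adjacent_intervals (hint _ _) (hint _ _), h1]
  have h5 : 1 / (4 * n * s) + 1 / (4 * n * s) = 1 / (2 * n * s) := by field_simp; norm_num
  linarith

theorem exists_isTrigPoly_majorant {ε δ : ℝ} (hε : 0 < ε) (hε1 : ε ≤ 1) (hδ : 0 < δ)
    (hδ2 : δ < 1 / 2) {J : ℕ} (hJ : 40 / (ε ^ 3 * δ) ≤ J) :
    ∃ f : ℝ → ℝ, (∀ x, 0 ≤ f x) ∧ (∀ x, distNearestInt x < δ → 1 ≤ f x) ∧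
      IsTrigPoly f J (2 * (1 + ε) ^ 2 * δ) := by
  have hJ0 : (0 : ℝ) < J := lt_of_lt_of_le (by positivity) hJ
  have hJ1 : 1 ≤ J := by exact_mod_cast hJ0
  have hr : 0 ≤ (1 + ε) * δ := by positivity
  have hnn : ∀ x, 0 ≤ ∫ y in (-((1 + ε) * δ))..((1 + ε) * δ), fejerKernel J (x - y) := fun x =>
    intervalIntegral.integral_nonneg (by linarith) fun y _ => fejerKernel_nonneg _ _
  refine ⟨fun x => (1 + ε) * ∫ y in (-((1 + ε) * δ))..((1 + ε) * δ), fejerKernel J (x - y),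
    fun x => mul_nonneg (by linarith) (hnn x), fun x hx => ?_, ?_⟩
  · have h1 : ∫ y in (-((1 + ε) * δ))..((1 + ε) * δ), fejerKernel J (x - y) =
        ∫ y in (x - round x - (1 + ε) * δ)..(x - round x + (1 + ε) * δ), fejerKernel J y := by
      have : ∀ y, fejerKernel J (x - y) = fejerKernel J (x - round x - y) := fun y => by
        rw [sub_right_comm, fejerKernel_sub_intCast]
      simp only [this]
      rw [intervalIntegral.integral_comp_sub_left (fun y => fejerKernel J y), sub_neg_eq_add]
    rw [distNearestInt, abs_lt] at hx
    have h2 : ∫ y in (-(ε * δ))..(ε * δ), fejerKernel J y ≤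
        ∫ y in (x - round x - (1 + ε) * δ)..(x - round x + (1 + ε) * δ), fejerKernel J y := by
      have := mul_pos hε hδ
      refine intervalIntegral.integral_mono_interval (by linarith) (by linarith) (by linarith)
        (Filter.Eventually.of_forall fun y => fejerKernel_nonneg _ _)
        ((continuous_fejerKernel J).intervalIntegrable _ _)
    have h3 := one_sub_le_integral_fejerKernel hJ1 (mul_pos hε hδ) (by nlinarith)
    have h4 : 1 / (2 * J * (ε * δ)) ≤ ε / 80 := by
      rw [div_le_iff₀ (by positivity)] at hJ
      rw [div_le_iff₀ (by positivity)]
      have : (J : ℝ) * (ε ^ 3 * δ) ≤ J * (ε ^ 2 * δ) := by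
        have := pow_le_pow_of_le_one hε.le hε1 (show 2 ≤ 3 by norm_num)
        exact mul_le_mul_of_nonneg_left (mul_le_mul_of_nonneg_right this hδ.le) hJ0.le
      nlinarith
    dsimp only
    rw [h1]
    nlinarith
  · have := ((isTrigPoly_fejerKernel hJ1).convolve hr).const_mul (t := 1 + ε) (by linarith)
    convert this using 1
    ring

theorem exists_isTrigPoly_minorant {ε δ : ℝ} (hε : 0 < ε) (hε1 : ε ≤ 1) (hδ : 0 < δ)
    (hδ2 : δ < 1 / 2) {J : ℕ} (hJ : 40 / (ε ^ 3 * δ) ≤ J) :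
    ∃ g t : ℝ → ℝ, ∃ b : ℝ, (∀ x, 0 ≤ g x) ∧ (∀ x, g x ≤ 1) ∧ (∀ x, 0 ≤ t x) ∧
      (∀ x, δ ≤ distNearestInt x → g x ≤ t x) ∧
      IsTrigPoly g J (2 * (1 - ε) * δ) ∧ IsTrigPoly t J b ∧ b ≤ ε * δ := by
  have hJ0 : (0 : ℝ) < J := lt_of_lt_of_le (by positivity) hJ
  have hJ1 : 1 ≤ J := by exact_mod_cast hJ0
  have hr : 0 ≤ (1 - ε) * δ := mul_nonneg (by linarith) hδ.le
  have hrδ : (1 - ε) * δ ≤ δ := by nlinarith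
  rw [div_le_iff₀ (by positivity)] at hJ
  let n : ℕ := ⌈1 / (2 * δ)⌉₊
  have hn1 : 1 ≤ n := Nat.ceil_pos.2 (by positivity)
  have hn0 : (0 : ℝ) < n := by exact_mod_cast hn1
  have hnδ : 1 / (2 * n) ≤ δ := by
    have : 1 / (2 * δ) ≤ n := Nat.le_ceil _
    rw [div_le_iff₀ (by positivity)] at this ⊢
    linarith
  have hnδ1 : n * δ ≤ 1 := by
    have h : (n : ℝ) < 1 / (2 * δ) + 1 := Nat.ceil_lt_add_one (by positivity)
    have h2 : (n : ℝ) * δ < (1 / (2 * δ) + 1) * δ := mul_lt_mul_of_pos_right h hδ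
    have h3 : (1 / (2 * δ) + 1) * δ = 1 / 2 + δ := by field_simp
    linarith
  have hnJ : n ≤ J := by
    have h1 : (J : ℝ) * (ε ^ 3 * δ) ≤ J * (1 * δ) := by
      gcongr
      exact pow_le_one₀ hε.le hε1
    have : (n : ℝ) * δ ≤ J * δ := by linarith
    exact_mod_cast le_of_mul_le_mul_right this hδ
  let κ : ℝ := 2 * Real.pi ^ 2 * (n * δ) / (J * ε ^ 2)
  have hκ : 0 ≤ κ := by positivity
  refine ⟨fun x => ∫ y in (-((1 - ε) * δ))..((1 - ε) * δ), fejerKernel J (x - y),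
    fun x => κ * (fejerKernel n x + fejerKernel n (x + 1 / (2 * n))), κ * (1 + 1), fun x => ?_,
    fun x => ?_, fun x => ?_, fun x hx => ?_, ?_, ?_, ?_⟩
  · exact intervalIntegral.integral_nonneg (by linarith) fun y _ => fejerKernel_nonneg _ _
  · have hper : Function.Periodic (fejerKernel J) 1 := fun y => by
      have := fejerKernel_sub_intCast J y (-1)
      simpa using this
    have h1 := hper.intervalIntegral_add_eq (x - 1 / 2) (-(1 / 2))
    rw [show (-(1 / 2) + 1 : ℝ) = 1 / 2 by norm_num,
      (isTrigPoly_fejerKernel hJ1).integral_eq] at h1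
    dsimp only
    rw [intervalIntegral.integral_comp_sub_left (fun y => fejerKernel J y), sub_neg_eq_add]
    refine le_trans ?_ h1.le
    exact intervalIntegral.integral_mono_interval (by linarith) (by linarith) (by linarith)
        (Filter.Eventually.of_forall fun y => fejerKernel_nonneg _ _)
        ((continuous_fejerKernel J).intervalIntegrable _ _)
  · exact mul_nonneg hκ (add_nonneg (fejerKernel_nonneg _ _) (fejerKernel_nonneg _ _))
  · set D := distNearestInt x with hD
    have hD0 : 0 < D := hδ.trans_le hx
    have h1 : ∀ y ∈ Set.Icc (-((1 - ε) * δ)) ((1 - ε) * δ),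
        fejerKernel J (x - y) ≤ 1 / (4 * J * (ε * D) ^ 2) := by
      intro y hy
      have h2 := distNearestInt_le_add x (x - y)
      rw [sub_sub_cancel] at h2
      have h3 := abs_le.2 hy
      have h4 : ε * D ≤ distNearestInt (x - y) := by nlinarith
      rw [le_div_iff₀ (by positivity)]
      refine le_trans ?_ (fejerKernel_mul_le_one hJ1 (x - y))
      have := fejerKernel_nonneg J (x - y)
      gcongr
    have h2 : ∫ y in (-((1 - ε) * δ))..((1 - ε) * δ), fejerKernel J (x - y) ≤
        2 * δ * (1 / (4 * J * (ε * D) ^ 2)) := by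
      calc _ ≤ ∫ y in (-((1 - ε) * δ))..((1 - ε) * δ), 1 / (4 * J * (ε * D) ^ 2) := by
            refine intervalIntegral.integral_mono_on (by linarith) ?_ (by simp) h1
            exact ((continuous_fejerKernel J).comp (by fun_prop)).intervalIntegrable _ _
        _ ≤ _ := by
          rw [intervalIntegral.integral_const, smul_eq_mul]
          gcongr
          linarith
    have h3 : 1 ≤ (fejerKernel n x + fejerKernel n (x + 1 / (2 * n))) *
        (n * (Real.pi * (2 * D)) ^ 2) := by
      refine (one_le_fejerKernel_add_shift hn1 x).trans ?_
      have := fejerKernel_nonneg n x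
      have := fejerKernel_nonneg n (x + 1 / (2 * n))
      have := Real.pi_pos
      gcongr
      linarith
    refine h2.trans ?_
    calc 2 * δ * (1 / (4 * J * (ε * D) ^ 2))
        ≤ 2 * δ * (1 / (4 * J * (ε * D) ^ 2)) *
          ((fejerKernel n x + fejerKernel n (x + 1 / (2 * n))) * (n * (Real.pi * (2 * D)) ^ 2)) :=
          le_mul_of_one_le_right (by positivity) h3
      _ = κ * (fejerKernel n x + fejerKernel n (x + 1 / (2 * n))) := by
          generalize fejerKernel n x + fejerKernel n (x + 1 / (2 * n)) = F
          simp only [κ]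
          field_simp
          ring
  · have := (isTrigPoly_fejerKernel hJ1).convolve hr
    convert this using 1
    ring
  · have h := isTrigPoly_fejerKernel hn1
    exact (((h.add (h.shift (1 / (2 * n)))).mono hnJ).const_mul hκ)
  · have hpi : Real.pi ^ 2 ≤ 10 := by
      have := Real.pi_lt_d2
      have := Real.pi_pos
      nlinarith
    have h1 : κ * (J * ε ^ 2) ≤ 20 := by
      simp only [κ]
      rw [div_mul_cancel₀ _ (by positivity)]
      calc 2 * Real.pi ^ 2 * (n * δ) ≤ 2 * 10 * 1 := by gcongr
        _ = 20 := by norm_num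
    have h2 : κ * (1 + 1) * (J * ε ^ 2) ≤ ε * δ * (J * ε ^ 2) := by nlinarith
    exact le_of_mul_le_mul_right h2 (by positivity)

end Majorants

section ExponentialSums

theorem norm_sum_Icc_unitExp_le (q : ℕ) {θ : ℝ} (hθ : 0 < distNearestInt θ) :
    ‖∑ a ∈ Finset.Icc (1 : ℤ) q, unitExp (a * θ)‖ ≤ (distNearestInt θ)⁻¹ := by
  have h1 : ∑ a ∈ Finset.Icc (1 : ℤ) q, unitExp (a * θ) =
      ∑ h ∈ Finset.range q, unitExp θ * unitExp (h * θ) := by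
    refine Finset.sum_nbij' (fun a => (a - 1).toNat) (fun h => (h : ℤ) + 1) ?_ ?_ ?_ ?_ ?_
    · intro a ha; simp only [Finset.mem_Icc, Finset.mem_range] at *; omega
    · intro a ha; simp only [Finset.mem_Icc, Finset.mem_range] at *; omega
    · intro a ha; simp only [Finset.mem_Icc] at *; omega
    · intro a ha; simp
    · intro a ha
      rw [Finset.mem_Icc] at ha
      have h2 : (((a - 1).toNat : ℕ) : ℝ) = a - 1 := by
        have : (((a - 1).toNat : ℕ) : ℤ) = a - 1 := Int.toNat_of_nonneg (by omega)
        exact_mod_cast this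
      rw [← unitExp_add, h2]
      congr 1; ring
  rw [h1, ← Finset.mul_sum, norm_mul, norm_unitExp, one_mul]
  have h2 := norm_sum_unitExp_mul q θ
  have h3 := two_mul_distNearestInt_le_abs_sin θ
  have h4 := Real.abs_sin_le_one (Real.pi * (q * θ))
  rw [inv_eq_one_div, le_div_iff₀ hθ]
  nlinarith [norm_nonneg (∑ h ∈ Finset.range q, unitExp (h * θ))]

theorem abs_sum_prod_sub_le {m d : ℕ} (q J : ℕ) (A : Matrix (Fin d) (Fin m) ℝ) (α : Fin m → ℝ)
    (hA : ∀ k : Fin m → ℤ, k ≠ 0 → ∀ u, 0 < distNearestInt (∑ j, A u j * k j))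
    (F : Fin m → ℝ → ℝ) (b : Fin m → ℝ) (hF : ∀ j, IsTrigPoly (F j) J (b j)) :
    |∑ a ∈ Fintype.piFinset (fun _ : Fin d => Finset.Icc (1 : ℤ) q),
        ∏ j, F j (α j + ∑ u, a u * A u j) - (∏ j, b j) * (q : ℝ) ^ d| ≤
      (∏ j, b j) * ∑ k ∈ (Fintype.piFinset fun _ : Fin m => Finset.Icc (-(J : ℤ)) J).erase 0,
        ∏ u, (distNearestInt (∑ j, A u j * k j))⁻¹ := by
  classical
  choose c hc0 hcb hFc using hF
  have h1 : ((∑ a ∈ Fintype.piFinset (fun _ : Fin d => Finset.Icc (1 : ℤ) q),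
        ∏ j, F j (α j + ∑ u, a u * A u j) : ℝ) : ℂ) =
      ∑ k ∈ Fintype.piFinset (fun _ : Fin m => Finset.Icc (-(J : ℤ)) J),
        (∏ j, c j (k j)) * unitExp (∑ j, k j * α j) *
          ∏ u, ∑ a ∈ Finset.Icc (1 : ℤ) q, unitExp (a * ∑ j, A u j * k j) := by
    push_cast
    simp only [hFc, Finset.prod_univ_sum]
    rw [Finset.sum_comm]
    refine Finset.sum_congr rfl fun k _ => ?_
    rw [Finset.mul_sum]
    refine Finset.sum_congr rfl fun a _ => ?_
    rw [Finset.prod_mul_distrib, mul_assoc, ← unitExp_sum, ← unitExp_sum, ← unitExp_add]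
    congr 2
    simp only [mul_add, Finset.sum_add_distrib, Finset.mul_sum]
    rw [Finset.sum_comm]
    congr 1
    refine Finset.sum_congr rfl fun u _ => Finset.sum_congr rfl fun j _ => ?_
    ring
  have h0 : (0 : Fin m → ℤ) ∈ Fintype.piFinset (fun _ : Fin m => Finset.Icc (-(J : ℤ)) J) := by
    simp
  rw [← Real.norm_eq_abs, ← Complex.norm_real, Complex.ofReal_sub, h1, ← Finset.add_sum_erase _ _ h0]
  have h2 : (∏ j, c j ((0 : Fin m → ℤ) j)) * unitExp (∑ j, ((0 : Fin m → ℤ) j : ℝ) * α j) *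
      ∏ u : Fin d, ∑ a ∈ Finset.Icc (1 : ℤ) q,
        unitExp (a * ∑ j, A u j * ((0 : Fin m → ℤ) j : ℝ)) =
      (((∏ j, b j) * (q : ℝ) ^ d : ℝ) : ℂ) := by
    simp [hc0, unitExp_zero]
  rw [h2, add_sub_cancel_left, Finset.mul_sum]
  refine (norm_sum_le _ _).trans (Finset.sum_le_sum fun k hk => ?_)
  rw [norm_mul, norm_mul, norm_unitExp, mul_one, norm_prod, norm_prod]
  refine mul_le_mul (Finset.prod_le_prod (fun _ _ => norm_nonneg _) fun j _ => hcb j _)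
    (Finset.prod_le_prod (fun _ _ => norm_nonneg _) fun u _ => ?_)
    (Finset.prod_nonneg fun _ _ => norm_nonneg _)
    (Finset.prod_nonneg fun j _ => (norm_nonneg _).trans (hcb j 0))
  exact norm_sum_Icc_unitExp_le q (hA k (Finset.ne_of_mem_erase hk) u)

end ExponentialSums

section Counting

theorem card_le_mul_add_sum {m d : ℕ} (q J : ℕ) (A : Matrix (Fin d) (Fin m) ℝ) (α : Fin m → ℝ)
    (hA : ∀ k : Fin m → ℤ, k ≠ 0 → ∀ u, 0 < distNearestInt (∑ j, A u j * k j))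
    {ε δ : ℝ} (hε : 0 < ε) (hε1 : ε ≤ 1) (hδ : 0 < δ) (hδ2 : δ < 1 / 2)
    (hJ : 40 / (ε ^ 3 * δ) ≤ J) :
    (((Fintype.piFinset (fun _ : Fin d => Finset.Icc (1 : ℤ) q)).filter fun a =>
        ∀ j, distNearestInt (α j + ∑ u, a u * A u j) < δ).card : ℝ) ≤
      (2 * (1 + ε) ^ 2 * δ) ^ m * ((q : ℝ) ^ d +
        ∑ k ∈ (Fintype.piFinset fun _ : Fin m => Finset.Icc (-(J : ℤ)) J).erase 0,
          ∏ u, (distNearestInt (∑ j, A u j * k j))⁻¹) := by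
  obtain ⟨f, hf0, hf1, hf⟩ := exists_isTrigPoly_majorant hε hε1 hδ hδ2 hJ
  have h1 := abs_sum_prod_sub_le q J A α hA (fun _ => f) (fun _ => 2 * (1 + ε) ^ 2 * δ)
    (fun _ => hf)
  simp only [Finset.prod_const (2 * (1 + ε) ^ 2 * δ), Finset.card_univ, Fintype.card_fin] at h1
  have h2 : (((Fintype.piFinset (fun _ : Fin d => Finset.Icc (1 : ℤ) q)).filter fun a =>
        ∀ j, distNearestInt (α j + ∑ u, a u * A u j) < δ).card : ℝ) ≤
      ∑ a ∈ Fintype.piFinset (fun _ : Fin d => Finset.Icc (1 : ℤ) q),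
        ∏ j, f (α j + ∑ u, a u * A u j) := by
    rw [Finset.natCast_card_filter]
    refine Finset.sum_le_sum fun a _ => ?_
    split_ifs with h
    · exact Finset.prod_const_one.symm.le.trans
        (Finset.prod_le_prod (fun _ _ => zero_le_one) fun j _ => hf1 _ (h j))
    · exact Finset.prod_nonneg fun j _ => hf0 _
  have h3 := (abs_le.1 h1).2
  linarith

theorem mul_sub_sum_le_card {m d : ℕ} (q J : ℕ) (A : Matrix (Fin d) (Fin m) ℝ) (α : Fin m → ℝ)
    (hA : ∀ k : Fin m → ℤ, k ≠ 0 → ∀ u, 0 < distNearestInt (∑ j, A u j * k j))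
    {ε δ : ℝ} (hε : 0 < ε) (hε1 : ε ≤ 1) (hδ : 0 < δ) (hδ2 : δ < 1 / 2)
    (hJ : 40 / (ε ^ 3 * δ) ≤ J) :
    (2 * δ) ^ m * (((1 - ε) ^ m - m * ε) * (q : ℝ) ^ d - (1 + m * ε) *
        ∑ k ∈ (Fintype.piFinset fun _ : Fin m => Finset.Icc (-(J : ℤ)) J).erase 0,
          ∏ u, (distNearestInt (∑ j, A u j * k j))⁻¹) ≤
      (((Fintype.piFinset (fun _ : Fin d => Finset.Icc (1 : ℤ) q)).filter fun a =>
        ∀ j, distNearestInt (α j + ∑ u, a u * A u j) < δ).card : ℝ) := by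
  obtain ⟨g, t, b, hg0, hg1, ht0, hgt, hg, ht, hb⟩ :=
    exists_isTrigPoly_minorant hε hε1 hδ hδ2 hJ
  set E := ∑ k ∈ (Fintype.piFinset fun _ : Fin m => Finset.Icc (-(J : ℤ)) J).erase 0,
          ∏ u, (distNearestInt (∑ j, A u j * k j))⁻¹ with hE
  have hE0 : 0 ≤ E := Finset.sum_nonneg fun k _ => Finset.prod_nonneg fun u _ =>
    inv_nonneg.2 (distNearestInt_nonneg _)
  set P := Fintype.piFinset (fun _ : Fin d => Finset.Icc (1 : ℤ) q) with hP
  let x : (Fin d → ℤ) → Fin m → ℝ := fun a j => α j + ∑ u, a u * A u j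
  have h1 : (2 * (1 - ε) * δ) ^ m * ((q : ℝ) ^ d - E) ≤ ∑ a ∈ P, ∏ j, g (x a j) := by
    have h := abs_sum_prod_sub_le q J A α hA (fun _ => g) (fun _ => 2 * (1 - ε) * δ) (fun _ => hg)
    simp only [Finset.prod_const (2 * (1 - ε) * δ), Finset.card_univ, Fintype.card_fin] at h
    have h' := (abs_le.1 h).1
    simp only [x]
    linarith
  have h2 : ∀ i, ∑ a ∈ P, ∏ j, (if j = i then t else g) (x a j) ≤
      (2 * δ) ^ m * ε * ((q : ℝ) ^ d + E) := by
    intro i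
    have hF : ∀ j, IsTrigPoly (if j = i then t else g) J
        (if j = i then b else 2 * (1 - ε) * δ) := by
      intro j; split_ifs
      · exact ht
      · exact hg
    have h := abs_sum_prod_sub_le q J A α hA _ _ hF
    have h' := (abs_le.1 h).2
    have h3 : ∏ j, (if j = i then b else 2 * (1 - ε) * δ) ≤ (2 * δ) ^ m * ε := by
      calc ∏ j, (if j = i then b else 2 * (1 - ε) * δ)
          ≤ ∏ j, (2 * δ) * (if j = i then ε else 1) := by
            refine Finset.prod_le_prod (fun j _ => (hF j).nonneg) fun j _ => ?_
            split_ifs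
            · nlinarith
            · nlinarith
        _ = _ := by
          rw [Finset.prod_mul_distrib, Finset.prod_ite_eq']
          simp
    simp only [x]
    have h4 : 0 ≤ (q : ℝ) ^ d + E := by positivity
    have h5 := mul_le_mul_of_nonneg_right h3 h4
    linarith
  have h3 : ∑ a ∈ P, (∏ j, g (x a j) - ∑ i, ∏ j, (if j = i then t else g) (x a j)) ≤
      ((P.filter fun a => ∀ j, distNearestInt (x a j) < δ).card : ℝ) := by
    rw [Finset.natCast_card_filter]
    refine Finset.sum_le_sum fun a _ => ?_
    have hnn : ∀ i, 0 ≤ ∏ j, (if j = i then t else g) (x a j) := fun i =>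
      Finset.prod_nonneg fun j _ => by
        split_ifs
        · exact ht0 _
        · exact hg0 _
    split_ifs with h
    · have h4 : ∏ j, g (x a j) ≤ 1 := Finset.prod_le_one (fun _ _ => hg0 _) fun _ _ => hg1 _
      have h5 := Finset.sum_nonneg fun i (_ : i ∈ Finset.univ) => hnn i
      linarith
    · push Not at h
      obtain ⟨i, hi⟩ := h
      have h4 : ∏ j, g (x a j) ≤ ∏ j, (if j = i then t else g) (x a j) := by
        refine Finset.prod_le_prod (fun _ _ => hg0 _) fun j _ => ?_
        split_ifs with hj
        · rw [hj]; exact hgt _ hi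
        · exact le_rfl
      have h5 := Finset.single_le_sum (fun i (_ : i ∈ Finset.univ) => hnn i) (Finset.mem_univ i)
      linarith
  rw [Finset.sum_sub_distrib, Finset.sum_comm] at h3
  have h4 := Finset.sum_le_sum fun i (_ : i ∈ (Finset.univ : Finset (Fin m))) => h2 i
  rw [Finset.sum_const, Finset.card_univ, Fintype.card_fin, nsmul_eq_mul] at h4
  have h5 : (2 * (1 - ε) * δ) ^ m = (2 * δ) ^ m * (1 - ε) ^ m := by rw [← mul_pow]; ring
  have h6 : (1 - ε) ^ m ≤ 1 := pow_le_one₀ (by linarith) (by linarith)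
  have h7 : (2 * δ) ^ m * ((1 - ε) ^ m * E) ≤ (2 * δ) ^ m * (1 * E) := by gcongr
  rw [h5] at h1
  refine le_trans ?_ h3
  linarith

theorem exists_pos_le_one_pow_bounds (m : ℕ) {η : ℝ} (hη : 0 < η) :
    ∃ ε : ℝ, 0 < ε ∧ ε ≤ 1 ∧ (2 * (1 + ε) ^ 2) ^ m ≤ 2 ^ m + η ∧
      2 ^ m - η ≤ 2 ^ m * ((1 - ε) ^ m - m * ε) := by
  have h1 : ∀ᶠ ε : ℝ in nhds 0, (2 * (1 + ε) ^ 2) ^ m < 2 ^ m + η := by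
    have : Continuous fun ε : ℝ => (2 * (1 + ε) ^ 2) ^ m := by fun_prop
    refine this.continuousAt.eventually_lt_const ?_
    simpa using hη
  have h2 : ∀ᶠ ε : ℝ in nhds 0, 2 ^ m - η < 2 ^ m * ((1 - ε) ^ m - m * ε) := by
    have : Continuous fun ε : ℝ => 2 ^ m * ((1 - ε) ^ m - m * ε) := by fun_prop
    refine this.continuousAt.eventually_const_lt ?_
    simpa using hη
  have h3 : ∀ᶠ ε : ℝ in nhds 0, ε < 1 := eventually_lt_nhds one_pos
  obtain ⟨ε, h, hε⟩ := (((h1.and (h2.and h3)).filter_mono nhdsWithin_le_nhds).and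
    (self_mem_nhdsWithin (s := Set.Ioi (0 : ℝ)))).exists
  exact ⟨ε, hε, h.2.2.le, h.1.le, h.2.1.le⟩

end Counting

section Assembly

theorem exists_mul_sum_prod_inv_le (m d : ℕ) (hm : 1 ≤ m) (φ : ℝ → ℝ)
    (hφ01 : ∀ x, 1 ≤ x → 0 < φ x ∧ φ x ≤ 1)
    (hφmono : ∀ x y, 1 ≤ x → x ≤ y → φ y ≤ φ x)
    (hφlam : ∀ lam : ℝ, 1 ≤ lam → ∃ clam : ℝ, 0 < clam ∧
      ∀ x : ℝ, 1 ≤ x → clam * φ x ≤ φ (lam * x)) {κ : ℝ} (hκ : 0 < κ) :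
    ∃ C : ℝ, 0 < C ∧ ∀ A : Matrix (Fin (d + 1)) (Fin m) ℝ,
      (∀ k : Fin m → ℤ, k ≠ 0 → φ (intSupNorm k) ≤
        intSupNorm k ^ m * ∏ i, distNearestInt (∑ j, A i j * (k j : ℝ))) →
      ∀ δ : ℝ, 0 < δ → δ < 1 / 2 → ∃ J : ℕ, κ / δ ≤ J ∧
        δ ^ m * ∑ k ∈ (Fintype.piFinset fun _ : Fin m => Finset.Icc (-(J : ℤ)) J).erase 0,
          ∏ u, (distNearestInt (∑ j, A u j * (k j : ℝ)))⁻¹ ≤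
        C * (Real.log ((1 / δ ^ m) / φ (1 / δ)) ^ (d + 1) +
          (1 / φ (1 / δ)) * Real.log ((1 / δ ^ m) / φ (1 / δ)) ^ d) := by
  obtain ⟨C₀, hC₀, hsum⟩ := exists_sum_prod_inv_le m d
  set K := κ + 1 with hK
  have hK1 : 1 ≤ K := by linarith
  obtain ⟨c, hc, hcφ⟩ := hφlam K hK1
  set l := Real.log 2 with hl
  have hl0 : 0 < l := Real.log_pos one_lt_two
  set B := (|Real.log (K ^ m / c)| / l + 2) / l with hB
  have hB0 : 0 < B := by positivity
  refine ⟨C₀ * K ^ m * (B ^ (d + 1) + B ^ d / c), by positivity, fun A hA δ hδ hδ2 => ?_⟩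
  have hδ1 : 2 < 1 / δ := by rw [lt_div_iff₀ hδ]; linarith
  set p := φ (1 / δ) with hp
  obtain ⟨hp0, hp1⟩ := hφ01 (1 / δ) (by linarith)
  rw [← hp] at hp0 hp1
  set J := ⌈κ / δ⌉₊ with hJ
  have hJpos : 1 ≤ J := Nat.ceil_pos.2 (by positivity)
  have hJ1 : (1 : ℝ) ≤ J := by exact_mod_cast hJpos
  have hJK : (J : ℝ) ≤ K * (1 / δ) := by
    have h : (J : ℝ) < κ / δ + 1 := Nat.ceil_lt_add_one (by positivity)
    have h2 : K * (1 / δ) = κ / δ + 1 / δ := by rw [hK]; ring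
    linarith
  have hJδ : δ * J ≤ K := by
    calc δ * J ≤ δ * (K * (1 / δ)) := by gcongr
      _ = K := by field_simp
  have hJδm : δ ^ m * (J : ℝ) ^ m ≤ K ^ m := by rw [← mul_pow]; gcongr
  obtain ⟨hy0, hy1⟩ := hφ01 J hJ1
  set y := φ J with hy
  have hcy : c * p ≤ y := (hcφ (1 / δ) (by linarith)).trans (hφmono _ _ hJ1 hJK)
  have hX1 : 1 ≤ (J : ℝ) ^ m / y := by
    rw [le_div_iff₀ hy0, one_mul]
    exact hy1.trans (one_le_pow₀ hJ1)
  obtain ⟨M, hM1, hM2⟩ := exists_nat_pow_near hX1 (one_lt_two : (1 : ℝ) < 2)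
  refine ⟨J, Nat.le_ceil _, ?_⟩
  have hE := hsum J hJpos A y hy0 (fun k hk hkJ => ?_) M hM1 hM2
  swap
  · refine le_trans (hφmono _ _ ?_ ?_) (hA k hk)
    · obtain ⟨j, hj⟩ := Function.ne_iff.1 hk
      have h1 : (1 : ℝ) ≤ |(k j : ℝ)| := by exact_mod_cast Int.one_le_abs hj
      exact h1.trans (norm_le_pi_norm (fun j => (k j : ℝ)) j)
    · exact (pi_norm_le_iff_of_nonneg (by positivity)).2 hkJ
  set Z := (1 / δ ^ m) / p with hZ
  have hZ2 : 2 ≤ Z := by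
    rw [hZ, le_div_iff₀ hp0, ← one_div_pow]
    have h1 : (1 / δ) ^ 1 ≤ (1 / δ) ^ m := pow_le_pow_right₀ (by linarith) hm
    nlinarith
  have hZ0 : 0 < Z := by linarith
  have hlog : l ≤ Real.log Z := Real.log_le_log two_pos hZ2
  have hXZ : (J : ℝ) ^ m / y ≤ K ^ m / c * Z := by
    calc (J : ℝ) ^ m / y ≤ (K * (1 / δ)) ^ m / (c * p) := by gcongr
      _ = K ^ m / c * Z := by rw [hZ, mul_pow, one_div_pow]; field_simp
  have hMlog : (M : ℝ) + 1 ≤ B * Real.log Z := by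
    have h1 : M * l ≤ |Real.log (K ^ m / c)| + Real.log Z := by
      calc M * l = Real.log (2 ^ M) := by rw [Real.log_pow]
        _ ≤ Real.log (K ^ m / c * Z) := Real.log_le_log (by positivity) (hM1.trans hXZ)
        _ = Real.log (K ^ m / c) + Real.log Z :=
          Real.log_mul (by positivity) hZ0.ne'
        _ ≤ _ := by gcongr; exact le_abs_self _
    have h2 : 1 ≤ Real.log Z / l := by rwa [le_div_iff₀ hl0, one_mul]
    have h3 : (M : ℝ) ≤ |Real.log (K ^ m / c)| / l + Real.log Z / l := by
      rw [← add_div, le_div_iff₀ hl0]; exact h1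
    have h4 : |Real.log (K ^ m / c)| / l * 1 ≤ |Real.log (K ^ m / c)| / l * (Real.log Z / l) := by
      gcongr
    have h5 : B * Real.log Z =
        |Real.log (K ^ m / c)| / l * (Real.log Z / l) + 2 * (Real.log Z / l) := by
      rw [hB]; ring
    linarith
  have hlog0 : 0 < Real.log Z := hl0.trans_le hlog
  have hδy : δ ^ m * (J : ℝ) ^ m / y ≤ K ^ m / (c * p) := by gcongr
  calc δ ^ m * ∑ k ∈ (Fintype.piFinset fun _ : Fin m => Finset.Icc (-(J : ℤ)) J).erase 0,
          ∏ u, (distNearestInt (∑ j, A u j * (k j : ℝ)))⁻¹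
      ≤ δ ^ m * (C₀ * ((J : ℝ) ^ m * (M + 1) ^ (d + 1) + (J : ℝ) ^ m / y * (M + 1) ^ d)) := by
        gcongr
    _ = C₀ * (δ ^ m * (J : ℝ) ^ m * (M + 1) ^ (d + 1) +
          δ ^ m * (J : ℝ) ^ m / y * (M + 1) ^ d) := by ring
    _ ≤ C₀ * (K ^ m * (B * Real.log Z) ^ (d + 1) + K ^ m / (c * p) * (B * Real.log Z) ^ d) := by
        gcongr
    _ = C₀ * K ^ m * (B ^ (d + 1) * Real.log Z ^ (d + 1) +
          B ^ d / c * (1 / p * Real.log Z ^ d)) := by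
        rw [mul_pow, mul_pow]; field_simp
    _ ≤ C₀ * K ^ m * ((B ^ (d + 1) + B ^ d / c) * (Real.log Z ^ (d + 1) +
          1 / p * Real.log Z ^ d)) := by
        gcongr
        have h1 : 0 ≤ B ^ (d + 1) * (1 / p * Real.log Z ^ d) := by positivity
        have h2 : 0 ≤ B ^ d / c * Real.log Z ^ (d + 1) := by positivity
        linarith
    _ = _ := by ring

theorem exists_abs_card_sub_le (m d : ℕ) (hm : 1 ≤ m) (φ : ℝ → ℝ)
    (hφ01 : ∀ x, 1 ≤ x → 0 < φ x ∧ φ x ≤ 1)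
    (hφmono : ∀ x y, 1 ≤ x → x ≤ y → φ y ≤ φ x)
    (hφlam : ∀ lam : ℝ, 1 ≤ lam → ∃ clam : ℝ, 0 < clam ∧
      ∀ x : ℝ, 1 ≤ x → clam * φ x ≤ φ (lam * x)) {ε' : ℝ} (hε' : 0 < ε') :
    ∃ C : ℝ, 0 < C ∧ ∀ (A : Matrix (Fin (d + 1)) (Fin m) ℝ) (α : Fin m → ℝ),
      (∀ k : Fin m → ℤ, k ≠ 0 → φ (intSupNorm k) ≤
        intSupNorm k ^ m * ∏ i, distNearestInt (∑ j, A i j * (k j : ℝ))) →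
      ∀ (q : ℕ) (δ : ℝ), 0 < δ → δ < 1 / 2 →
        |(((Fintype.piFinset (fun _ : Fin (d + 1) => Finset.Icc (1 : ℤ) q)).filter fun a =>
            ∀ j, distNearestInt (α j + ∑ u, a u * A u j) < δ).card : ℝ) -
          2 ^ m * δ ^ m * (q : ℝ) ^ (d + 1)| ≤
        ε' * δ ^ m * (q : ℝ) ^ (d + 1) +
          C * (Real.log ((1 / δ ^ m) / φ (1 / δ)) ^ (d + 1) +
            (1 / φ (1 / δ)) * Real.log ((1 / δ ^ m) / φ (1 / δ)) ^ d) := by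
  obtain ⟨ε, hε, hε1, hup, hlow⟩ := exists_pos_le_one_pow_bounds m hε'
  obtain ⟨C, hC, h⟩ := exists_mul_sum_prod_inv_le m d hm φ hφ01 hφmono hφlam
    (show 0 < 40 / ε ^ 3 by positivity)
  refine ⟨(2 ^ m + ε' + 2 ^ m * (1 + m * ε)) * C, by positivity, fun A α hA q δ hδ hδ2 => ?_⟩
  obtain ⟨J, hJ, hE⟩ := h A hA δ hδ hδ2
  rw [div_div] at hJ
  have hpos : ∀ k : Fin m → ℤ, k ≠ 0 → ∀ u, 0 < distNearestInt (∑ j, A u j * k j) := by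
    intro k hk u
    refine (distNearestInt_nonneg _).lt_of_ne fun h0 => ?_
    have h1 := hA k hk
    rw [Finset.prod_eq_zero (Finset.mem_univ u) h0.symm, mul_zero] at h1
    obtain ⟨j, hj⟩ := Function.ne_iff.1 hk
    have h2 : (1 : ℝ) ≤ |(k j : ℝ)| := by exact_mod_cast Int.one_le_abs hj
    exact h1.not_gt (hφ01 _ (h2.trans (norm_le_pi_norm (fun j => (k j : ℝ)) j))).1
  have h1 := card_le_mul_add_sum q J A α hpos hε hε1 hδ hδ2 hJ
  have h2 := mul_sub_sum_le_card q J A α hpos hε hε1 hδ hδ2 hJ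
  set E := ∑ k ∈ (Fintype.piFinset fun _ : Fin m => Finset.Icc (-(J : ℤ)) J).erase 0,
          ∏ u, (distNearestInt (∑ j, A u j * k j))⁻¹ with hEdef
  have hE0 : 0 ≤ E := Finset.sum_nonneg fun k _ => Finset.prod_nonneg fun u _ =>
    inv_nonneg.2 (distNearestInt_nonneg _)
  set R := Real.log ((1 / δ ^ m) / φ (1 / δ)) ^ (d + 1) +
            (1 / φ (1 / δ)) * Real.log ((1 / δ ^ m) / φ (1 / δ)) ^ d with hR
  rw [mul_pow _ δ] at h1
  rw [mul_pow 2 δ] at h2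
  have hR0 : 0 ≤ C * R := le_trans (by positivity) hE
  have h3 : (2 * (1 + ε) ^ 2) ^ m * δ ^ m * ((q : ℝ) ^ (d + 1) + E) ≤
      (2 ^ m + ε') * δ ^ m * ((q : ℝ) ^ (d + 1) + E) := by gcongr
  have h4 : (2 ^ m - ε') * (δ ^ m * (q : ℝ) ^ (d + 1)) ≤
      2 ^ m * ((1 - ε) ^ m - m * ε) * (δ ^ m * (q : ℝ) ^ (d + 1)) := by gcongr
  have h5 : (2 ^ m + ε') * (δ ^ m * E) ≤ (2 ^ m + ε') * (C * R) := by gcongr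
  have h6 : 2 ^ m * (1 + m * ε) * (δ ^ m * E) ≤ 2 ^ m * (1 + m * ε) * (C * R) := by gcongr
  have h7 : 0 ≤ (2 ^ m + ε') * (C * R) := by positivity
  have h8 : 0 ≤ 2 ^ m * (1 + m * ε) * (C * R) := by positivity
  rw [abs_le]
  constructor <;> linarith

end Assembly

/-- **Lemma 7.2** (refined version of Huang–Liu, Theorem 7): asymptotic count of
`𝒜(q,δ)` for a `φ`-semi multiplicatively badly approximable `A`. -/
theorem count_rational_points_near_subspace (N d : ℕ) (hd : 1 ≤ d) (hdN : d < N)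
    (φ : ℝ → ℝ) (hφ01 : ∀ x, 1 ≤ x → 0 < φ x ∧ φ x ≤ 1)
    (hφmono : ∀ x y, 1 ≤ x → x ≤ y → φ y ≤ φ x)
    (hφlam : ∀ lam : ℝ, 1 ≤ lam → ∃ clam : ℝ, 0 < clam ∧
      ∀ x : ℝ, 1 ≤ x → clam * φ x ≤ φ (lam * x)) :
    ∀ ε' : ℝ, 0 < ε' → ∃ C : ℝ, 0 < C ∧
      ∀ (A : Matrix (Fin d) (Fin (N - d)) ℝ) (α₀ : Fin (N - d) → ℝ)
        (Atil : Matrix (Fin (d + 1)) (Fin (N - d)) ℝ),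
        Atil = Matrix.of (Fin.cons α₀ (fun i => A i)) →
        -- `A` is `φ`-semi multiplicatively badly approximable
        (∀ q : Fin (N - d) → ℤ, q ≠ 0 →
          φ (intSupNorm q) ≤ intSupNorm q ^ (N - d) *
            ∏ i, distNearestInt (∑ j, A i j * (q j : ℝ))) →
      ∀ q : ℕ, 1 ≤ q → ∀ δ : ℝ, 0 < δ → δ < 1 / 2 →
        abs ((Set.ncard {a : Fin d → ℤ | (∀ u, 0 < a u ∧ a u ≤ (q : ℤ)) ∧
                ∀ j, distNearestInt
                  (Matrix.vecMul (Fin.cons (q : ℝ) (fun u => (a u : ℝ))) Atil j) < δ} : ℝ) -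
            2 ^ (N - d) * δ ^ (N - d) * (q : ℝ) ^ d) ≤
          ε' * δ ^ (N - d) * (q : ℝ) ^ d +
            C * (Real.log ((1 / δ ^ (N - d)) / φ (1 / δ)) ^ d +
              (1 / φ (1 / δ)) * Real.log ((1 / δ ^ (N - d)) / φ (1 / δ)) ^ (d - 1)) := by
  obtain ⟨d, rfl⟩ := Nat.exists_eq_add_of_le' hd
  intro ε' hε'
  obtain ⟨C, hC, h⟩ := exists_abs_card_sub_le (N - (d + 1)) d (by omega) φ hφ01 hφmono hφlam hε'
  refine ⟨C, hC, fun A α₀ Atil hAtil hA q _ δ hδ hδ2 => ?_⟩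
  have hset : {a : Fin (d + 1) → ℤ | (∀ u, 0 < a u ∧ a u ≤ (q : ℤ)) ∧
      ∀ j, distNearestInt
        (Matrix.vecMul (Fin.cons (q : ℝ) (fun u => (a u : ℝ))) Atil j) < δ} =
      ((Fintype.piFinset (fun _ : Fin (d + 1) => Finset.Icc (1 : ℤ) q)).filter fun a =>
        ∀ j, distNearestInt (q * α₀ j + ∑ u, a u * A u j) < δ) := by
    ext a
    simp only [Set.mem_ofPred_eq, Finset.coe_filter, Fintype.mem_piFinset, Finset.mem_Icc,
      Int.lt_iff_add_one_le, zero_add]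
    refine and_congr_right fun _ => forall_congr' fun j => ?_
    simp [hAtil, Matrix.vecMul, dotProduct, Fin.sum_univ_succ (n := d + 1)]
  rw [hset, Set.ncard_coe_finset]
  exact h A (fun j => q * α₀ j) hA q δ hδ hδ2
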